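/- arXiv:2507.07200 — 2 statements merged into one kernel-verified Lean document; each statement's English description precedes it below -/
import Mathlib

section
/- Let X be a Polish space, p ≥ 1, μ ∈ P(X), ν ∈ P_p(ℝ^d), and let C : X × P_p(ℝ^d) → [0,∞] be lower semicontinuous and convex in its second argument. If C is decreasing in the convex order in its second argument (i.e. ρ₁ ≼_c ρ₂ implies C(x,ρ₁) ≥ C(x,ρ₂) for all x ∈ X), then inf_{π ∈ Π(μ,ν)} ∫_X C(x, π_x) dμ(x) = sup { ∫_X ψ^C dμ − ∫_{ℝ^d} ψ dν : ψ ∈ C_{b,p}(ℝ^d), ψ convex }. -/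
open MeasureTheory Set Filter Topology
open scoped ENNReal

noncomputable section

/-- `ℝ^d`, modelled as Euclidean space. -/
abbrev Rd (d : ℕ) : Type := EuclideanSpace ℝ (Fin d)

/-- A Borel measure on `ℝ^d` has finite `p`-th moment. -/
def HasMomentP (p : ℝ) {d : ℕ} (ρ : Measure (Rd d)) : Prop :=
  ∫⁻ y, ENNReal.ofReal (‖y‖ ^ p) ∂ρ ≠ ⊤

/-- `P_p(ℝ^d)`: Borel probability measures on `ℝ^d` with finite `p`-th moment. -/
abbrev Pp (p : ℝ) (d : ℕ) : Type :=
  {ρ : Measure (Rd d) // IsProbabilityMeasure ρ ∧ HasMomentP p ρ}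

/-- Continuous test functions of growth of order at most `p`. -/
def GrowthP (p : ℝ) {d : ℕ} (f : Rd d → ℝ) : Prop :=
  Continuous f ∧ ∃ K : ℝ, ∀ y, |f y| ≤ K * (1 + ‖y‖ ^ p)

/-- The `p`-weak topology on `P_p(ℝ^d)`: the initial topology induced by integration
against continuous functions of growth of order at most `p`. -/
instance PpTopology (p : ℝ) (d : ℕ) : TopologicalSpace (Pp p d) :=
  ⨅ f : {f : Rd d → ℝ // GrowthP p f},
    TopologicalSpace.induced (fun ρ : Pp p d => ∫ y, f.1 y ∂ρ.1) inferInstance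

instance PpMeasurableSpace (p : ℝ) (d : ℕ) : MeasurableSpace (Pp p d) := borel _

/-- `C_{b,p}(ℝ^d)`: continuous functions bounded from below by a constant and bounded
above by `K (1 + |y - y₀|^p)` for some `K > 0`, `y₀`. -/
def Cbp (p : ℝ) {d : ℕ} (ψ : Rd d → ℝ) : Prop :=
  Continuous ψ ∧ (∃ c : ℝ, ∀ y, c ≤ ψ y) ∧
    ∃ K : ℝ, 0 < K ∧ ∃ y₀ : Rd d, ∀ y, ψ y ≤ K * (1 + ‖y - y₀‖ ^ p)

open scoped Classical in
/-- The nonnegative part of an extended real, as an extended nonnegative real. -/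
def erealToENN (x : EReal) : ℝ≥0∞ := if x = ⊤ then ⊤ else ENNReal.ofReal x.toReal

/-- Canonical extended integral of an `EReal`-valued function: the lower integral of the
positive part minus the lower integral of the negative part. -/
def eInt {α : Type*} [MeasurableSpace α] (μ : Measure α) (f : α → EReal) : EReal :=
  ((∫⁻ x, erealToENN (f x) ∂μ : ℝ≥0∞) : EReal) -
    ((∫⁻ x, erealToENN (-(f x)) ∂μ : ℝ≥0∞) : EReal)

/-- The convex order on measures on `ℝ^d`: `ρ₁ ≼_c ρ₂` iff `∫ f dρ₁ ≤ ∫ f dρ₂` for every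
convex function `f : ℝ^d → ℝ` (integrals taken in the extended sense). -/
def ConvexOrder {d : ℕ} (ρ₁ ρ₂ : Measure (Rd d)) : Prop :=
  ∀ f : Rd d → ℝ, ConvexOn ℝ univ f →
    eInt ρ₁ (fun y => (f y : EReal)) ≤ eInt ρ₂ (fun y => (f y : EReal))

/-- Coordinatewise increasing functions on `ℝ^d`. -/
def CoordMono {d : ℕ} (f : Rd d → ℝ) : Prop :=
  ∀ y z : Rd d, (∀ i, y i ≤ z i) → f y ≤ f z

/-- The increasing convex order on measures on `ℝ^d`. -/
def IcxOrder {d : ℕ} (ρ₁ ρ₂ : Measure (Rd d)) : Prop :=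
  ∀ f : Rd d → ℝ, ConvexOn ℝ univ f → CoordMono f →
    eInt ρ₁ (fun y => (f y : EReal)) ≤ eInt ρ₂ (fun y => (f y : EReal))

/-- `π` is a coupling of `μ` and `ν`. -/
def IsCoupling {X Y : Type*} [MeasurableSpace X] [MeasurableSpace Y]
    (π : Measure (X × Y)) (μ : Measure X) (ν : Measure Y) : Prop :=
  IsProbabilityMeasure π ∧ π.map Prod.fst = μ ∧ π.map Prod.snd = ν

open scoped Classical in
/-- Disintegration of a measure on a product space with respect to its first marginal. -/
def disint {X : Type*} [MeasurableSpace X] {Y : Type*} [MeasurableSpace Y]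
    [StandardBorelSpace Y] [Nonempty Y] (π : Measure (X × Y)) :
    ProbabilityTheory.Kernel X Y :=
  if h : IsFiniteMeasure π then (haveI := h; π.condKernel) else 0

/-- The primal weak optimal transport value `inf_{π ∈ Π(μ,ν)} ∫ C(x, π_x) dμ(x)`. -/
def primal {X : Type*} [MeasurableSpace X] {d : ℕ}
    (μ : Measure X) (ν : Measure (Rd d)) (C : X → Measure (Rd d) → ℝ≥0∞) : ℝ≥0∞ :=
  ⨅ π : {π : Measure (X × Rd d) // IsCoupling π μ ν}, ∫⁻ x, C x (disint π.1 x) ∂μ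

/-- The `C`-conjugate `ψ^C (x) = inf_{ρ ∈ P_p} ρ(ψ) + C(x, ρ)`. -/
def conj (p : ℝ) {X : Type*} [MeasurableSpace X] {d : ℕ}
    (C : X → Measure (Rd d) → ℝ≥0∞) (ψ : Rd d → ℝ) (x : X) : EReal :=
  ⨅ ρ : Pp p d, ((∫ y, ψ y ∂ρ.1 : ℝ) : EReal) + ((C x ρ.1 : ℝ≥0∞) : EReal)

/-- The dual value `μ(ψ^C) - ν(ψ)`. -/
def dualVal (p : ℝ) {X : Type*} [MeasurableSpace X] {d : ℕ}
    (μ : Measure X) (ν : Measure (Rd d)) (C : X → Measure (Rd d) → ℝ≥0∞)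
    (ψ : Rd d → ℝ) : EReal :=
  eInt μ (conj p C ψ) - ((∫ y, ψ y ∂ν : ℝ) : EReal)

end

section Moments

variable {d : ℕ} {p : ℝ}

lemma continuous_norm_rpow (hp : 0 ≤ p) : Continuous fun y : Rd d => ‖y‖ ^ p :=
  continuous_norm.rpow_const fun _ => Or.inr hp

lemma hasMomentP_iff_integrable (hp : 0 ≤ p) (ρ : Measure (Rd d)) :
    HasMomentP p ρ ↔ Integrable (fun y => ‖y‖ ^ p) ρ :=
  lintegral_ofReal_ne_top_iff_integrable (continuous_norm_rpow hp).aestronglyMeasurable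
    (ae_of_all _ fun _ => by positivity)

lemma GrowthP.integrable (hp : 0 ≤ p) {f : Rd d → ℝ} (hf : GrowthP p f) {ρ : Measure (Rd d)}
    [IsFiniteMeasure ρ] (hρ : HasMomentP p ρ) : Integrable f ρ := by
  obtain ⟨hc, K, hK⟩ := hf
  have h := ((hasMomentP_iff_integrable hp ρ).1 hρ)
  exact (((integrable_const (1 : ℝ)).add h).const_mul K).mono' hc.aestronglyMeasurable
    (ae_of_all _ fun y => by simpa using hK y)

lemma GrowthP.integrable_pp (hp : 0 ≤ p) {f : Rd d → ℝ} (hf : GrowthP p f) (ρ : Pp p d) :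
    Integrable f ρ.1 := by
  have := ρ.2.1
  exact hf.integrable hp ρ.2.2

lemma GrowthP.add {f g : Rd d → ℝ} (hf : GrowthP p f) (hg : GrowthP p g) :
    GrowthP p fun y => f y + g y := by
  obtain ⟨hfc, K, hK⟩ := hf
  obtain ⟨hgc, K', hK'⟩ := hg
  exact ⟨hfc.add hgc, K + K', fun y => by
    have := abs_add_le (f y) (g y)
    linarith [hK y, hK' y]⟩

lemma GrowthP.const_mul {f : Rd d → ℝ} (hf : GrowthP p f) (a : ℝ) :
    GrowthP p fun y => a * f y := by
  obtain ⟨hfc, K, hK⟩ := hf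
  exact ⟨hfc.const_mul a, |a| * K, fun y => by
    rw [abs_mul, mul_assoc]
    exact mul_le_mul_of_nonneg_left (hK y) (abs_nonneg a)⟩

lemma GrowthP.of_bounded {f : Rd d → ℝ} (hc : Continuous f) {M : ℝ} (hM : ∀ y, |f y| ≤ M) :
    GrowthP p f := by
  refine ⟨hc, M, fun y => ?_⟩
  have h0 : 0 ≤ M := (abs_nonneg _).trans (hM y)
  have : (0 : ℝ) ≤ ‖y‖ ^ p := by positivity
  nlinarith [hM y]

lemma GrowthP.const (a : ℝ) : GrowthP p fun _ : Rd d => a :=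
  GrowthP.of_bounded continuous_const fun _ => le_rfl

lemma GrowthP.sum {ι : Type*} (s : Finset ι) {f : ι → Rd d → ℝ}
    (hf : ∀ i ∈ s, GrowthP p (f i)) : GrowthP p fun y => ∑ i ∈ s, f i y := by
  classical
  induction s using Finset.induction_on with
  | empty => simpa using GrowthP.const 0
  | insert a s ha ih =>
    simp only [Finset.sum_insert ha]
    exact (hf a (by simp)).add (ih fun i hi => hf i (by simp [hi]))

lemma add_rpow_le_two_rpow (hp : 1 ≤ p) {a b : ℝ} (ha : 0 ≤ a) (hb : 0 ≤ b) :
    (a + b) ^ p ≤ 2 ^ (p - 1) * (a ^ p + b ^ p) := by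
  lift a to NNReal using ha
  lift b to NNReal using hb
  exact_mod_cast NNReal.rpow_add_le_mul_rpow_add_rpow a b hp

lemma Cbp.growthP (hp : 1 ≤ p) {ψ : Rd d → ℝ} (hψ : Cbp p ψ) : GrowthP p ψ := by
  obtain ⟨hc, ⟨c, hcl⟩, K, hK, y₀, hu⟩ := hψ
  refine ⟨hc, |c| + K * (1 + 2 ^ (p - 1) * (1 + ‖y₀‖ ^ p)), fun y => ?_⟩
  have h1 : ‖y - y₀‖ ^ p ≤ 2 ^ (p - 1) * (‖y‖ ^ p + ‖y₀‖ ^ p) :=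
    (Real.rpow_le_rpow (norm_nonneg _) (norm_sub_le _ _) (by linarith)).trans
      (add_rpow_le_two_rpow hp (norm_nonneg _) (norm_nonneg _))
  set A : ℝ := 2 ^ (p - 1)
  set B := ‖y‖ ^ p
  set D := ‖y₀‖ ^ p
  have hA : 0 ≤ A := by positivity
  have hB : 0 ≤ B := by positivity
  have hD : 0 ≤ D := by positivity
  have h2 : K * (1 + ‖y - y₀‖ ^ p) ≤ K * (1 + A * (B + D)) := by gcongr
  have h3 : K * (1 + A * (B + D)) ≤ K * (1 + A * (1 + D)) * (1 + B) := by
    have : 0 ≤ K * (B + A + A * D * B) := by positivity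
    nlinarith
  have h4 : |c| ≤ |c| * (1 + B) := by nlinarith [abs_nonneg c]
  have h5 : 0 ≤ K * (1 + A * (1 + D)) * (1 + B) := by positivity
  rw [abs_le]
  constructor
  · nlinarith [hcl y, neg_abs_le c]
  · nlinarith [hu y, abs_nonneg c]

lemma Cbp.of_growthP {ψ : Rd d → ℝ} (hψ : GrowthP p ψ) {c : ℝ} (hc : ∀ y, c ≤ ψ y) :
    Cbp p ψ := by
  obtain ⟨h, K, hK⟩ := hψ
  refine ⟨h, ⟨c, hc⟩, |K| + 1, by positivity, 0, fun y => ?_⟩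
  have : (0 : ℝ) ≤ ‖y‖ ^ p := by positivity
  rw [sub_zero]
  nlinarith [hK y, le_abs_self (ψ y), le_abs_self K]

lemma continuous_integral_pp {f : Rd d → ℝ} (hf : GrowthP p f) :
    Continuous fun ρ : Pp p d => ∫ y, f y ∂ρ.1 :=
  continuous_iInf_dom (i := ⟨f, hf⟩) continuous_induced_dom

lemma tendsto_pp {ι : Type*} {l : Filter ι} {u : ι → Pp p d} {ρ : Pp p d}
    (h : ∀ f : Rd d → ℝ, GrowthP p f → Tendsto (fun i => ∫ y, f y ∂(u i).1) l
      (𝓝 (∫ y, f y ∂ρ.1))) : Tendsto u l (𝓝 ρ) := by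
  rw [nhds_iInf, tendsto_iInf]
  rintro ⟨f, hf⟩
  rw [nhds_induced, tendsto_comap_iff]
  exact h f hf

end Moments

section Separation

variable {d : ℕ} {p : ℝ}

noncomputable section

/-- The mixture `t ρ₁ + (1 - t) ρ₂` as an element of `P_p`. -/
def Pp.mix (t : ℝ≥0∞) (ht : t ≤ 1) (ρ₁ ρ₂ : Pp p d) : Pp p d :=
  ⟨t • ρ₁.1 + (1 - t) • ρ₂.1, by
    have := ρ₁.2.1
    have := ρ₂.2.1
    constructor
    · constructor
      simp [add_tsub_cancel_of_le ht]
    · unfold HasMomentP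
      rw [lintegral_add_measure, lintegral_smul_measure, lintegral_smul_measure]
      have h1 : t ≠ ⊤ := ne_top_of_le_ne_top ENNReal.one_ne_top ht
      exact ENNReal.add_ne_top.2 ⟨ENNReal.mul_ne_top h1 ρ₁.2.2,
        ENNReal.mul_ne_top (ENNReal.sub_ne_top ENNReal.one_ne_top) ρ₂.2.2⟩⟩

end

lemma Pp.integral_mix (hp : 0 ≤ p) {a b : ℝ} (ha : 0 ≤ a) (hb : 0 ≤ b) (hab : a + b = 1)
    (ht : ENNReal.ofReal a ≤ 1) (ρ₁ ρ₂ : Pp p d) {f : Rd d → ℝ} (hf : GrowthP p f) :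
    ∫ y, f y ∂(Pp.mix (ENNReal.ofReal a) ht ρ₁ ρ₂).1
      = a * ∫ y, f y ∂ρ₁.1 + b * ∫ y, f y ∂ρ₂.1 := by
  have hb' : 1 - ENNReal.ofReal a = ENNReal.ofReal b := by
    rw [← ENNReal.ofReal_one, ← ENNReal.ofReal_sub _ ha]
    congr 1
    linarith
  change ∫ y, f y ∂(ENNReal.ofReal a • ρ₁.1 + (1 - ENNReal.ofReal a) • ρ₂.1) = _
  rw [hb', integral_add_measure, integral_smul_measure, integral_smul_measure,
    ENNReal.toReal_ofReal ha, ENNReal.toReal_ofReal hb, smul_eq_mul, smul_eq_mul]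
  · exact (hf.integrable_pp hp ρ₁).smul_measure ENNReal.ofReal_ne_top
  · exact (hf.integrable_pp hp ρ₂).smul_measure ENNReal.ofReal_ne_top

/-- A lower semicontinuous convex nonnegative functional on `P_p` is the supremum of its
continuous affine minorants. -/
lemma exists_affine_minorant (hp : 0 ≤ p) {F : Measure (Rd d) → ℝ≥0∞}
    (hlsc : LowerSemicontinuous fun ρ : Pp p d => F ρ.1)
    (hconv : ∀ ρ₁ ρ₂ : Pp p d, ∀ t : ℝ≥0∞, t ≤ 1 →
      F (t • ρ₁.1 + (1 - t) • ρ₂.1) ≤ t * F ρ₁.1 + (1 - t) * F ρ₂.1)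
    (ρ₀ : Pp p d) {t : ℝ} (ht : ENNReal.ofReal t < F ρ₀.1) :
    ∃ f : Rd d → ℝ, GrowthP p f ∧
      (∀ ρ : Pp p d, ENNReal.ofReal (∫ y, f y ∂ρ.1) ≤ F ρ.1) ∧ t < ∫ y, f y ∂ρ₀.1 := by
  classical
  obtain ⟨t', hr1, hr2⟩ := ENNReal.lt_iff_exists_nnreal_btwn.1 ht
  have htt' : t < t' := by
    rw [← ENNReal.ofReal_coe_nnreal] at hr1
    exact lt_of_not_ge fun h => absurd hr1 (not_lt.2 (ENNReal.ofReal_le_ofReal h))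
  have hnhds := hlsc ρ₀ _ hr2
  set Φ : Pp p d → ({f : Rd d → ℝ // GrowthP p f} → ℝ) := fun ρ f => ∫ y, f.1 y ∂ρ.1 with hΦ
  have htop : PpTopology p d = TopologicalSpace.induced Φ Pi.topologicalSpace := by
    rw [induced_to_pi]; rfl
  rw [htop, nhds_induced, nhds_pi] at hnhds
  obtain ⟨V, hV, hVs⟩ := hnhds
  obtain ⟨I, hI, s, hs, hIs⟩ := Filter.mem_pi.1 hV
  have := hI.fintype
  have hball : ∀ f, ∃ ε > 0, Metric.ball (Φ ρ₀ f) ε ⊆ s f := fun f =>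
    Metric.mem_nhds_iff.1 (hs f)
  choose ε hε hεs using hball
  let A : Set ((I → ℝ) × ℝ) := (univ.pi fun i : I => Metric.ball (Φ ρ₀ i) (ε i)) ×ˢ Iio (t' : ℝ)
  let T : Set ((I → ℝ) × ℝ) :=
    {q | ∃ ρ : Pp p d, 0 ≤ q.2 ∧ F ρ.1 ≤ ENNReal.ofReal q.2 ∧ q.1 = fun i : I => Φ ρ i}
  have hAo : IsOpen A :=
    (isOpen_set_pi finite_univ fun _ _ => Metric.isOpen_ball).prod isOpen_Iio
  have hAc : Convex ℝ A :=
    (convex_pi fun _ _ => convex_ball _ _).prod (convex_Iio _)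
  have hTc : Convex ℝ T := by
    rintro ⟨u₁, r₁⟩ ⟨ρ₁, h1, h1', h1''⟩ ⟨u₂, r₂⟩ ⟨ρ₂, h2, h2', h2''⟩ a b ha hb hab
    have ha1 : ENNReal.ofReal a ≤ 1 := ENNReal.ofReal_le_one.2 (by linarith)
    refine ⟨Pp.mix (ENNReal.ofReal a) ha1 ρ₁ ρ₂, ?_, ?_, ?_⟩
    · simp only at h1 h2
      simp only [Prod.smul_mk, Prod.mk_add_mk, smul_eq_mul]
      positivity
    · have hb' : 1 - ENNReal.ofReal a = ENNReal.ofReal b := by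
        rw [← ENNReal.ofReal_one, ← ENNReal.ofReal_sub _ ha]
        congr 1
        linarith
      refine (hconv ρ₁ ρ₂ _ ha1).trans ?_
      simp only at h1 h2
      simp only [Prod.smul_mk, Prod.mk_add_mk, smul_eq_mul]
      rw [hb', ENNReal.ofReal_add (by positivity) (by positivity), ENNReal.ofReal_mul ha,
        ENNReal.ofReal_mul hb]
      gcongr
    · simp only at h1'' h2''
      simp only [Prod.smul_mk, Prod.mk_add_mk]
      funext i
      rw [h1'', h2'']
      exact (Pp.integral_mix hp ha hb hab ha1 ρ₁ ρ₂ i.1.2).symm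
  have hdisj : Disjoint A T := by
    rw [Set.disjoint_left]
    rintro ⟨u, r⟩ ⟨hu, hr⟩ ⟨ρ, h0, h1, h2⟩
    have hmem : ρ ∈ {ρ : Pp p d | (t' : ℝ≥0∞) < F ρ.1} := by
      apply hVs
      apply hIs
      intro f hf
      apply hεs
      have := hu ⟨f, hf⟩ (mem_univ _)
      simp only at h2
      rw [h2] at this
      exact this
    have h3 : (t' : ℝ≥0∞) < ENNReal.ofReal r := lt_of_lt_of_le hmem h1
    rw [← ENNReal.ofReal_coe_nnreal] at h3
    exact absurd h3 (not_lt.2 (ENNReal.ofReal_le_ofReal (le_of_lt hr)))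
  obtain ⟨ℓ, c, hℓA, hℓT⟩ := geometric_hahn_banach_open hAc hAo hTc hdisj
  set β : ℝ := ℓ (0, 1) with hβ
  set a : I → ℝ := fun i => ℓ (Pi.single i 1, 0) with ha
  have hℓ : ∀ u r, ℓ (u, r) = ∑ i, a i * u i + β * r := by
    intro u r
    have h1 : ℓ (u, r) = ℓ (u, 0) + ℓ (0, r) := by rw [← map_add]; simp
    have h2 : ℓ (0, r) = β * r := by
      have : ((0 : I → ℝ), r) = r • ((0 : I → ℝ), (1 : ℝ)) := by simp
      rw [this, map_smul, smul_eq_mul, mul_comm]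
    have h3 : ℓ (u, 0) = ∑ i, a i * u i := by
      have := LinearMap.pi_apply_eq_sum_univ
        ((ℓ : (I → ℝ) × ℝ →ₗ[ℝ] ℝ).comp (LinearMap.inl ℝ (I → ℝ) ℝ)) u
      simp only [LinearMap.comp_apply, LinearMap.inl_apply, smul_eq_mul] at this
      refine this.trans (Finset.sum_congr rfl fun i _ => ?_)
      have hi : (fun j : I => if i = j then (1 : ℝ) else 0) = Pi.single i 1 := by
        funext j
        simp [Pi.single_apply, eq_comm]
      rw [mul_comm, hi]
      rfl
    rw [h1, h2, h3]
  set g : Rd d → ℝ := fun y => ∑ i : I, a i * i.1.1 y with hg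
  have hgG : GrowthP p g := GrowthP.sum _ fun i _ => i.1.2.const_mul (a i)
  have hgi : ∀ ρ : Pp p d, ∫ y, g y ∂ρ.1 = ∑ i : I, a i * Φ ρ i := by
    intro ρ
    rw [integral_finsetSum _ fun i _ => (i.1.2.const_mul (a i)).integrable_pp hp ρ]
    simp only [integral_const_mul, hΦ]
  have hT : ∀ (ρ : Pp p d) (r : ℝ), 0 ≤ r → F ρ.1 ≤ ENNReal.ofReal r →
      c ≤ ∫ y, g y ∂ρ.1 + β * r := by
    intro ρ r h0 h1
    have := hℓT (fun i : I => Φ ρ i, r) ⟨ρ, h0, h1, rfl⟩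
    rwa [hℓ, ← hgi] at this
  have hA : ∀ r < (t' : ℝ), ∫ y, g y ∂ρ₀.1 + β * r < c := by
    intro r hr
    have := hℓA (fun i : I => Φ ρ₀ i, r) ⟨fun i _ => Metric.mem_ball_self (hε i), hr⟩
    rwa [hℓ, ← hgi] at this
  have hβ0 : 0 ≤ β := by
    by_contra! hneg
    have h := hA (min ((t' : ℝ) - 1) ((c - ∫ y, g y ∂ρ₀.1) / β))
      ((min_le_left _ _).trans_lt (by linarith))
    have h2 : β * ((c - ∫ y, g y ∂ρ₀.1) / β) ≤ β * min ((t' : ℝ) - 1) ((c - ∫ y, g y ∂ρ₀.1) / β) :=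
      mul_le_mul_of_nonpos_left (min_le_right _ _) hneg.le
    rw [mul_div_cancel₀ _ hneg.ne] at h2
    linarith
  have key : ∀ (M : ℝ), 0 ≤ M → M * β ≤ 1 → ∃ f : Rd d → ℝ, GrowthP p f ∧
      (∀ ρ : Pp p d, ENNReal.ofReal (∫ y, f y ∂ρ.1) ≤ F ρ.1) ∧
      ∫ y, f y ∂ρ₀.1 = M * (c - ∫ y, g y ∂ρ₀.1) := by
    intro M hM hMβ
    have h_int : ∀ ρ : Pp p d, ∫ y, (M * c + (-M) * g y) ∂ρ.1 = M * (c - ∫ y, g y ∂ρ.1) := by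
      intro ρ
      have := ρ.2.1
      rw [integral_add (integrable_const _) ((hgG.const_mul _).integrable_pp hp ρ),
        integral_const_mul (-M)]
      simp
      ring
    refine ⟨fun y => M * c + (-M) * g y, (GrowthP.const _).add (hgG.const_mul _), ?_, h_int _⟩
    intro ρ
    rw [h_int]
    by_cases htop : F ρ.1 = ⊤
    · rw [htop]; exact le_top
    · rw [ENNReal.ofReal_le_iff_le_toReal htop]
      have h1 := hT ρ (F ρ.1).toReal ENNReal.toReal_nonneg (by rw [ENNReal.ofReal_toReal htop])
      have h2 : (0 : ℝ) ≤ (F ρ.1).toReal := ENNReal.toReal_nonneg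
      nlinarith
  rcases hβ0.eq_or_lt with h0 | hpos
  · have hpos : 0 < c - ∫ y, g y ∂ρ₀.1 := by
      have := hA (t' - 1) (by linarith)
      rw [← h0] at this
      linarith
    obtain ⟨f, hf1, hf2, hf3⟩ := key ((|t| + 1) / (c - ∫ y, g y ∂ρ₀.1)) (by positivity)
      (by rw [← h0]; simp)
    refine ⟨f, hf1, hf2, ?_⟩
    rw [hf3, div_mul_cancel₀ _ hpos.ne']
    linarith [le_abs_self t]
  · obtain ⟨f, hf1, hf2, hf3⟩ := key β⁻¹ (by positivity) (by rw [inv_mul_cancel₀ hpos.ne'])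
    refine ⟨f, hf1, hf2, ?_⟩
    rw [hf3]
    have := hA t htt'
    rw [inv_mul_eq_div, lt_div_iff₀ hpos]
    linarith

end Separation

section Compactness

variable {d : ℕ} {p : ℝ}

/-- The tail function `(‖y‖^p - R)⁺`. -/
noncomputable def tailFn (p : ℝ) (d : ℕ) (R : ℝ) (y : Rd d) : ℝ := max (‖y‖ ^ p - R) 0

lemma tailFn_nonneg (R : ℝ) (y : Rd d) : 0 ≤ tailFn p d R y := le_max_right _ _

lemma tailFn_growthP (hp : 0 ≤ p) (R : ℝ) : GrowthP p (tailFn p d R) := by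
  refine ⟨((continuous_norm_rpow hp).sub continuous_const).max continuous_const,
    1 + |R|, fun y => ?_⟩
  have h : (0 : ℝ) ≤ ‖y‖ ^ p := by positivity
  rw [abs_of_nonneg (tailFn_nonneg R y)]
  refine max_le ?_ (by positivity)
  nlinarith [neg_abs_le R, abs_nonneg R]

lemma tailFn_anti {R R' : ℝ} (h : R ≤ R') (y : Rd d) : tailFn p d R' y ≤ tailFn p d R y :=
  max_le_max (by linarith) le_rfl

lemma le_tailFn (R : ℝ) (y : Rd d) : ‖y‖ ^ p - R ≤ tailFn p d R y := le_max_left _ _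

lemma tendsto_integral_tailFn (hp : 0 ≤ p) (ρ : Pp p d) :
    Tendsto (fun n : ℕ => ∫ y, tailFn p d n y ∂ρ.1) atTop (𝓝 0) := by
  have h := tendsto_integral_of_dominated_convergence (μ := ρ.1)
    (F := fun (n : ℕ) y => tailFn p d n y) (f := fun _ => 0) (fun y => ‖y‖ ^ p)
    (fun n => (tailFn_growthP hp n).1.aestronglyMeasurable)
    ((hasMomentP_iff_integrable hp _).1 ρ.2.2)
    (fun n => ae_of_all _ fun y => by
      rw [Real.norm_of_nonneg (tailFn_nonneg _ y)]
      exact max_le (by linarith [(Nat.cast_nonneg n : (0 : ℝ) ≤ n)]) (by positivity))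
    (ae_of_all _ fun y => by
      obtain ⟨N, hN⟩ := exists_nat_ge (‖y‖ ^ p)
      refine tendsto_atTop_of_eventually_const (i₀ := N) fun n hn => ?_
      have : (N : ℝ) ≤ n := by exact_mod_cast hn
      exact max_eq_right (by linarith))
  simpa using h

lemma exists_integral_tailFn_le (hp : 0 ≤ p) (ρ : Pp p d) {η : ℝ} (hη : 0 < η) :
    ∃ R : ℝ, ∫ y, tailFn p d R y ∂ρ.1 ≤ η := by
  obtain ⟨n, hn⟩ := ((tendsto_integral_tailFn hp ρ).eventually (ge_mem_nhds hη)).exists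
  exact ⟨n, hn⟩

lemma clamp_growth {K R : ℝ} (hK : 0 ≤ K) {f : Rd d → ℝ} (hf : ∀ y, |f y| ≤ K * (1 + ‖y‖ ^ p))
    (y : Rd d) :
    |f y - max (-(K * (1 + R))) (min (f y) (K * (1 + R)))| ≤ K * tailFn p d R y := by
  have h1 := hf y
  have h2 : K * (‖y‖ ^ p - R) ≤ K * tailFn p d R y :=
    mul_le_mul_of_nonneg_left (le_tailFn R y) hK
  have h3 : 0 ≤ K * tailFn p d R y := mul_nonneg hK (tailFn_nonneg R y)
  rw [abs_le] at h1 ⊢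
  rcases max_cases (-(K * (1 + R))) (min (f y) (K * (1 + R))) with h | h <;>
  rcases min_cases (f y) (K * (1 + R)) with h' | h' <;>
  constructor <;> nlinarith

lemma hasMomentP_of_tail {ρ : Measure (Rd d)} [IsFiniteMeasure ρ] {R : ℝ}
    (h : ∫⁻ y, ENNReal.ofReal (tailFn p d R y) ∂ρ ≠ ⊤) : HasMomentP p ρ := by
  refine ne_top_of_le_ne_top (b := ∫⁻ y, (ENNReal.ofReal |R| + ENNReal.ofReal (tailFn p d R y)) ∂ρ)
    ?_ (lintegral_mono fun y => ?_)
  · rw [lintegral_add_left measurable_const]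
    refine ENNReal.add_ne_top.2 ⟨?_, h⟩
    rw [lintegral_const]
    exact ENNReal.mul_ne_top ENNReal.ofReal_ne_top (measure_ne_top _ _)
  · rw [← ENNReal.ofReal_add (abs_nonneg _) (tailFn_nonneg _ _)]
    exact ENNReal.ofReal_le_ofReal (by linarith [le_tailFn (p := p) R y, le_abs_self R])

/-- A sequence in `P_p` with uniformly integrable `p`-th moments has a cluster point. -/
lemma exists_cluster_pp (hp : 1 ≤ p) (u : ℕ → Pp p d)
    (hu : ∀ η > 0, ∃ R : ℝ, ∀ᶠ n in atTop, ∫ y, tailFn p d R y ∂(u n).1 ≤ η) :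
    ∃ (ρ : Pp p d) (l : Ultrafilter ℕ), (l : Filter ℕ) ≤ atTop ∧ Tendsto u l (𝓝 ρ) := by
  have hp0 : 0 ≤ p := by linarith
  let v : ℕ → ProbabilityMeasure (Rd d) := fun n => ⟨(u n).1, (u n).2.1⟩
  have htight : IsTightMeasureSet (range fun n => (u n).1) := by
    have : ∀ i, IsFiniteMeasure (u i).1 := fun i => by have := (u i).2.1; infer_instance
    refine isTightMeasureSet_range_of_tendsto_limsup_measure_norm_gt ?_
    rw [ENNReal.tendsto_nhds_zero]
    intro ε hε
    by_cases hεt : ε = ⊤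
    · exact Eventually.of_forall fun r => by rw [hεt]; exact le_top
    have hε' : 0 < ε.toReal := ENNReal.toReal_pos hε.ne' hεt
    obtain ⟨R, hR⟩ := hu ε.toReal hε'
    filter_upwards [eventually_ge_atTop (|R| + 1)] with r hr
    refine limsup_le_of_le (h := ?_)
    filter_upwards [hR] with n hn
    have := (u n).2.1
    have hr1 : 1 ≤ r := by linarith [abs_nonneg R]
    have hsub : {y : Rd d | r < ‖y‖} ⊆ {y | (1 : ℝ) ≤ tailFn p d R y} := by
      intro y hy
      have h1 : r < ‖y‖ := hy
      have h2 : ‖y‖ ≤ ‖y‖ ^ p := by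
        conv_lhs => rw [← Real.rpow_one ‖y‖]
        exact Real.rpow_le_rpow_of_exponent_le (by linarith) hp
      have := le_tailFn (p := p) R y
      change (1 : ℝ) ≤ _
      linarith [le_abs_self R]
    have hm := mul_meas_ge_le_integral_of_nonneg (μ := (u n).1)
      (ae_of_all _ fun y => tailFn_nonneg R y) ((tailFn_growthP hp0 R).integrable_pp hp0 (u n)) 1
    rw [one_mul] at hm
    refine (measure_mono hsub).trans ?_
    rw [← ENNReal.ofReal_toReal hεt, ← ENNReal.ofReal_toReal (measure_ne_top (u n).1 _)]
    exact ENNReal.ofReal_le_ofReal (hm.trans hn)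
  have hcomp : IsCompact (closure (range v)) := by
    apply isCompact_closure_of_isTightMeasureSet
    convert htight using 1
    ext m
    constructor
    · rintro ⟨_, ⟨n, rfl⟩, rfl⟩
      exact ⟨n, rfl⟩
    · rintro ⟨n, rfl⟩
      exact ⟨_, ⟨n, rfl⟩, rfl⟩
  let l : Ultrafilter ℕ := Filter.hyperfilter ℕ
  have hl : (l : Filter ℕ) ≤ atTop := by
    rw [← Nat.cofinite_eq_atTop]; exact hyperfilter_le_cofinite
  obtain ⟨P, -, hP⟩ := isCompact_iff_ultrafilter_le_nhds.1 hcomp (l.map v) (by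
    rw [le_principal_iff]
    exact Filter.mem_map.2 (Eventually.of_forall fun n => subset_closure (mem_range_self n)))
  have hPt : Tendsto v l (𝓝 P) := hP
  have h_int : ∀ (f : Rd d → ℝ) (M : ℝ), Continuous f → (∀ y, |f y| ≤ M) →
      Tendsto (fun n => ∫ y, f y ∂(u n).1) l (𝓝 (∫ y, f y ∂(P : Measure (Rd d)))) := by
    intro f M hf hM
    exact (ProbabilityMeasure.tendsto_iff_forall_integral_tendsto.1 hPt)
      (BoundedContinuousFunction.ofNormedAddCommGroup f hf M hM)
  have hPtail : ∀ η > 0, ∃ R, (∀ᶠ n in (l : Filter ℕ), ∫ y, tailFn p d R y ∂(u n).1 ≤ η) ∧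
      ∫⁻ y, ENNReal.ofReal (tailFn p d R y) ∂(P : Measure (Rd d)) ≤ ENNReal.ofReal η := by
    intro η hη
    obtain ⟨R, hR⟩ := hu η hη
    refine ⟨R, hl hR, ?_⟩
    have hsup : ∀ y : Rd d, ENNReal.ofReal (tailFn p d R y)
        = ⨆ N : ℕ, ENNReal.ofReal (min (tailFn p d R y) N) := by
      intro y
      apply le_antisymm
      · obtain ⟨N, hN⟩ := exists_nat_ge (tailFn p d R y)
        exact le_iSup_of_le N (by rw [min_eq_left hN])
      · exact iSup_le fun N => ENNReal.ofReal_le_ofReal (min_le_left _ _)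
    simp_rw [hsup]
    have hcont : ∀ N : ℕ, Continuous fun y : Rd d => min (tailFn p d R y) N := fun N =>
      (tailFn_growthP hp0 R).1.min continuous_const
    have hbd : ∀ (N : ℕ) (y : Rd d), |min (tailFn p d R y) N| ≤ N := fun N y => by
      rw [abs_of_nonneg (le_min (tailFn_nonneg R y) (Nat.cast_nonneg N))]
      exact min_le_right _ _
    rw [lintegral_iSup (fun N => (hcont N).measurable.ennreal_ofReal)]
    · refine iSup_le fun N => ?_
      rw [← ofReal_integral_eq_lintegral_ofReal]
      · refine ENNReal.ofReal_le_ofReal (le_of_tendsto (h_int _ N (hcont N) (hbd N)) ?_)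
        filter_upwards [hl hR] with n hn
        have := (u n).2.1
        refine le_trans (integral_mono ?_ ?_ fun y => min_le_left _ _) hn
        · exact (GrowthP.of_bounded (p := p) (hcont N) (hbd N)).integrable_pp hp0 (u n)
        · exact (tailFn_growthP hp0 R).integrable_pp hp0 (u n)
      · exact (integrable_const (N : ℝ)).mono' (hcont N).aestronglyMeasurable
          (ae_of_all _ (hbd N))
      · exact ae_of_all _ fun y => le_min (tailFn_nonneg R y) (Nat.cast_nonneg N)
    · intro N N' h y
      exact ENNReal.ofReal_le_ofReal (min_le_min le_rfl (by exact_mod_cast h))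
  have hPm : HasMomentP p (P : Measure (Rd d)) := by
    obtain ⟨R, -, hR⟩ := hPtail 1 one_pos
    exact hasMomentP_of_tail (ne_top_of_le_ne_top ENNReal.ofReal_ne_top hR)
  let ρ : Pp p d := ⟨P, P.2, hPm⟩
  refine ⟨ρ, l, hl, tendsto_pp fun f hf => ?_⟩
  obtain ⟨hfc, K₀, hK₀⟩ := id hf
  set K := |K₀| + 1 with hK
  have hKpos : 0 < K := by positivity
  have hfK : ∀ y, |f y| ≤ K * (1 + ‖y‖ ^ p) := fun y =>
    (hK₀ y).trans (mul_le_mul_of_nonneg_right (by linarith [le_abs_self K₀]) (by positivity))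
  rw [Metric.tendsto_nhds]
  intro ε hε
  obtain ⟨R, hR1, hR2⟩ := hPtail (ε / (4 * K)) (by positivity)
  set g : Rd d → ℝ := fun y => max (-(K * (1 + R))) (min (f y) (K * (1 + R))) with hg
  have hgc : Continuous g := continuous_const.max (hfc.min continuous_const)
  have hgb : ∀ y, |g y| ≤ |K * (1 + R)| := by
    intro y
    rw [abs_le]
    refine ⟨le_max_of_le_left (neg_le_neg (le_abs_self _)), max_le (neg_le_abs _) ?_⟩
    exact (min_le_right _ _).trans (le_abs_self _)
  have hgG : GrowthP p g := GrowthP.of_bounded hgc hgb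
  have hdiff : ∀ ρ' : Pp p d, |∫ y, f y ∂ρ'.1 - ∫ y, g y ∂ρ'.1|
      ≤ K * ∫ y, tailFn p d R y ∂ρ'.1 := by
    intro ρ'
    rw [← integral_sub (hf.integrable_pp hp0 ρ') (hgG.integrable_pp hp0 ρ'),
      ← integral_const_mul]
    refine (abs_integral_le_integral_abs).trans (integral_mono ?_ ?_ fun y => ?_)
    · exact ((hf.integrable_pp hp0 ρ').sub (hgG.integrable_pp hp0 ρ')).abs
    · exact ((tailFn_growthP hp0 R).integrable_pp hp0 ρ').const_mul K
    · exact clamp_growth hKpos.le hfK y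
  have hρt : ∫ y, tailFn p d R y ∂ρ.1 ≤ ε / (4 * K) := by
    rw [← ENNReal.ofReal_le_ofReal_iff (by positivity), ofReal_integral_eq_lintegral_ofReal
      ((tailFn_growthP hp0 R).integrable_pp hp0 ρ) (ae_of_all _ fun y => tailFn_nonneg R y)]
    exact hR2
  have hg' := (Metric.tendsto_nhds.1 (h_int g _ hgc hgb)) (ε / 4) (by positivity)
  filter_upwards [hR1, hg'] with n hn1 hn2
  have e1 := hdiff (u n)
  have e2 := hdiff ρ
  have e3 : K * (ε / (4 * K)) = ε / 4 := by field_simp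
  have e4 := mul_le_mul_of_nonneg_left hn1 hKpos.le
  have e5 := mul_le_mul_of_nonneg_left hρt hKpos.le
  rw [Real.dist_eq] at hn2 ⊢
  rw [e3] at e4 e5
  have e1' := abs_le.1 (e1.trans e4)
  have e2' := abs_le.1 (e2.trans e5)
  have hn2' := abs_lt.1 hn2
  rw [abs_lt]
  constructor
  · linarith [e1'.1, e2'.2, hn2'.1]
  · linarith [e1'.2, e2'.1, hn2'.2]

end Compactness

section Testing

variable {d : ℕ} {p : ℝ}

/-- A continuous cutoff equal to `1` on the ball of radius `r` and `0` off radius `r + 1`. -/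
noncomputable def cutoff {E : Type*} [NormedAddCommGroup E] (r : ℝ) (y : E) : ℝ :=
  max 0 (min 1 (r + 1 - ‖y‖))

lemma cutoff_continuous {E : Type*} [NormedAddCommGroup E] (r : ℝ) :
    Continuous (cutoff r : E → ℝ) := by
  unfold cutoff
  fun_prop

lemma cutoff_nonneg {E : Type*} [NormedAddCommGroup E] (r : ℝ) (y : E) : 0 ≤ cutoff r y :=
  le_max_left _ _

lemma cutoff_le_one {E : Type*} [NormedAddCommGroup E] (r : ℝ) (y : E) : cutoff r y ≤ 1 :=
  max_le zero_le_one (min_le_left _ _)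

lemma cutoff_eq_one {E : Type*} [NormedAddCommGroup E] {r : ℝ} {y : E} (h : ‖y‖ ≤ r) :
    cutoff r y = 1 := by
  unfold cutoff
  rw [min_eq_left (by linarith), max_eq_right zero_le_one]

lemma cutoff_eq_zero {E : Type*} [NormedAddCommGroup E] {r : ℝ} {y : E} (h : r + 1 ≤ ‖y‖) :
    cutoff r y = 0 := max_eq_left ((min_le_right _ _).trans (by linarith))

/-- A countable family of compactly supported continuous test functions. -/
noncomputable def testFn (d : ℕ) (k r : ℕ) (y : Rd d) : ℝ :=
  cutoff (r : ℝ) y * TopologicalSpace.denseSeq C(Rd d, ℝ) k y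

lemma testFn_continuous (k r : ℕ) : Continuous (testFn d k r) :=
  (cutoff_continuous _).mul (ContinuousMap.continuous _)

lemma testFn_bounded (k r : ℕ) : ∃ M : ℝ, ∀ y, |testFn d k r y| ≤ M := by
  obtain ⟨M, hM⟩ := (isCompact_closedBall (0 : Rd d) (r + 1)).exists_bound_of_continuousOn
    (testFn_continuous k r).continuousOn
  refine ⟨max M 0, fun y => ?_⟩
  by_cases h : ‖y‖ ≤ r + 1
  · exact le_max_of_le_left (hM y (by simpa using h))
  · unfold testFn
    rw [cutoff_eq_zero (by linarith)]
    simp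

lemma exists_denseSeq_close (f : C(Rd d, ℝ)) {K : Set (Rd d)} (hK : IsCompact K) {ε : ℝ}
    (hε : 0 < ε) :
    ∃ k, ∀ y ∈ K, |TopologicalSpace.denseSeq C(Rd d, ℝ) k y - f y| ≤ ε := by
  have h := (ContinuousMap.tendsto_iff_forall_isCompact_tendstoUniformlyOn (p := 𝓝 f)
    (F := id)).1 tendsto_id K hK
  have h2 := Metric.tendstoUniformlyOn_iff.1 h ε hε
  obtain ⟨k, hk⟩ := (TopologicalSpace.denseRange_denseSeq C(Rd d, ℝ)).mem_nhds h2
  refine ⟨k, fun y hy => ?_⟩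
  have := hk y hy
  rw [dist_comm, Real.dist_eq] at this
  exact this.le

lemma exists_testFn_close (hp : 1 ≤ p) {f : Rd d → ℝ} (hf : Continuous f) {K : ℝ} (hK : 0 ≤ K)
    (hfK : ∀ y, |f y| ≤ K * (1 + ‖y‖ ^ p)) {R : ℝ} (hR : 0 ≤ R) {ε : ℝ} (hε : 0 < ε) :
    ∃ k r, ∀ y, |testFn d k r y - f y| ≤ ε + 4 * K * tailFn p d R y := by
  obtain ⟨r, hr⟩ := exists_nat_ge (2 * R + 1)
  obtain ⟨k, hk⟩ := exists_denseSeq_close ⟨f, hf⟩ (isCompact_closedBall (0 : Rd d) (r + 1)) hε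
  refine ⟨k, r, fun y => ?_⟩
  have h1 : |testFn d k r y - cutoff (r : ℝ) y * f y| ≤ ε := by
    unfold testFn
    rw [← mul_sub, abs_mul, abs_of_nonneg (cutoff_nonneg _ _)]
    by_cases h : ‖y‖ ≤ r + 1
    · exact (mul_le_of_le_one_left (abs_nonneg _) (cutoff_le_one _ _)).trans
        (hk y (by simpa using h))
    · rw [cutoff_eq_zero (by linarith), zero_mul]
      exact hε.le
  have h2 : |cutoff (r : ℝ) y * f y - f y| ≤ 4 * K * tailFn p d R y := by
    have h0 : 0 ≤ 4 * K * tailFn p d R y := mul_nonneg (by linarith) (tailFn_nonneg _ _)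
    by_cases h : ‖y‖ ≤ r
    · rw [cutoff_eq_one h]
      simpa using h0
    · push Not at h
      have e1 : |cutoff (r : ℝ) y * f y - f y| ≤ |f y| := by
        have : cutoff (r : ℝ) y * f y - f y = -((1 - cutoff (r : ℝ) y) * f y) := by ring
        rw [this, abs_neg, abs_mul, abs_of_nonneg (by linarith [cutoff_le_one (r : ℝ) y])]
        exact mul_le_of_le_one_left (abs_nonneg _) (by linarith [cutoff_nonneg (r : ℝ) y])
      have e2 : ‖y‖ ≤ ‖y‖ ^ p := by
        conv_lhs => rw [← Real.rpow_one ‖y‖]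
        exact Real.rpow_le_rpow_of_exponent_le (by linarith) hp
      have e3 := le_tailFn (p := p) R y
      refine e1.trans ((hfK y).trans ?_)
      have e4 : 1 + ‖y‖ ^ p ≤ 4 * tailFn p d R y := by linarith
      nlinarith
  calc |testFn d k r y - f y| = |(testFn d k r y - cutoff (r : ℝ) y * f y)
        + (cutoff (r : ℝ) y * f y - f y)| := by ring_nf
    _ ≤ _ := (abs_add_le _ _).trans (add_le_add h1 h2)

/-- `Ψ` is an increasing sequence of functions of `p`-growth that eventually
dominates every multiple of some tail function. -/
structure TailDominating (p : ℝ) {d : ℕ} (Ψ : ℕ → Rd d → ℝ) : Prop where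
  growth : ∀ n, GrowthP p (Ψ n)
  nonneg : ∀ n y, 0 ≤ Ψ n y
  mono : ∀ y, Monotone fun n => Ψ n y
  dominates : ∀ a : ℝ, 0 < a → ∃ R : ℝ, ∃ n₀ : ℕ, ∀ n ≥ n₀, ∀ y, a * tailFn p d R y ≤ Ψ n y

lemma exists_nhds_valid (hp : 1 ≤ p) {X : Type*} [TopologicalSpace X] [FirstCountableTopology X]
    {C : X → Measure (Rd d) → ℝ≥0∞}
    (hlsc : LowerSemicontinuous fun q : X × Pp p d => C q.1 q.2.1)
    {Ψ : ℕ → Rd d → ℝ} (hΨ : TailDominating p Ψ) {δ : ℝ} (hδ : 0 < δ) (x₀ : X)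
    {f : Rd d → ℝ} (hfc : Continuous f) {M : ℝ} (hM : ∀ y, |f y| ≤ M) (n₀ : ℕ)
    (hf : ∀ ρ : Pp p d,
      ENNReal.ofReal (∫ y, f y ∂ρ.1 - δ * ∫ y, Ψ n₀ y ∂ρ.1 - δ / 2) ≤ C x₀ ρ.1) :
    ∃ U ∈ 𝓝 x₀, ∃ n, ∀ x ∈ U, ∀ ρ : Pp p d,
      ENNReal.ofReal (∫ y, f y ∂ρ.1 - δ * ∫ y, Ψ n y ∂ρ.1 - δ) ≤ C x ρ.1 := by
  have hp0 : 0 ≤ p := by linarith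
  by_contra! hcon
  obtain ⟨V, hV⟩ := (𝓝 x₀).exists_antitone_basis
  choose x hx ρ hρ using fun m => hcon (V m) (hV.1.mem_of_mem trivial) m
  have hs : ∀ m, δ * ∫ y, Ψ m y ∂(ρ m).1 ≤ M := by
    intro m
    have h1 : 0 < ∫ y, f y ∂(ρ m).1 - δ * ∫ y, Ψ m y ∂(ρ m).1 - δ :=
      ENNReal.ofReal_pos.1 (pos_of_gt (hρ m))
    have := (ρ m).2.1
    have h2 : ∫ y, f y ∂(ρ m).1 ≤ ∫ _, M ∂(ρ m).1 :=
      integral_mono ((GrowthP.of_bounded (p := p) hfc hM).integrable_pp hp0 _)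
        (integrable_const _) fun y => (le_abs_self _).trans (hM y)
    simp at h2
    linarith
  obtain ⟨ρ', l, hl, hlim⟩ := exists_cluster_pp hp ρ (by
    intro η hη
    obtain ⟨R, n₁, h⟩ := hΨ.dominates ((|M| + 1) / (δ * η)) (by positivity)
    refine ⟨R, eventually_atTop.2 ⟨n₁, fun m hm => ?_⟩⟩
    have h1 : (|M| + 1) / (δ * η) * ∫ y, tailFn p d R y ∂(ρ m).1 ≤ ∫ y, Ψ m y ∂(ρ m).1 := by
      rw [← integral_const_mul]
      exact integral_mono (((tailFn_growthP hp0 R).integrable_pp hp0 _).const_mul _)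
        ((hΨ.growth m).integrable_pp hp0 _) (h m hm)
    have h2 := mul_le_mul_of_nonneg_left h1 hδ.le
    have h3 := h2.trans (hs m)
    have h4 : δ * ((|M| + 1) / (δ * η) * ∫ y, tailFn p d R y ∂(ρ m).1)
        = (|M| + 1) * ((∫ y, tailFn p d R y ∂(ρ m).1) / η) := by field_simp
    rw [h4] at h3
    have h5 : (∫ y, tailFn p d R y ∂(ρ m).1) / η ≤ 1 := by
      by_contra! hc
      nlinarith [le_abs_self M, abs_nonneg M]
    rwa [div_le_one hη] at h5)
  have hxl : Tendsto x l (𝓝 x₀) := (hV.tendsto hx).mono_left hl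
  have hpair : Tendsto (fun m => (x m, ρ m)) l (𝓝 (x₀, ρ')) := hxl.prodMk_nhds hlim
  set s : Pp p d → ℝ := fun ρ => ∫ y, f y ∂ρ.1 - δ * ∫ y, Ψ n₀ y ∂ρ.1 - δ with hsdef
  have hscont : Continuous s :=
    ((continuous_integral_pp (GrowthP.of_bounded hfc hM)).sub
      ((continuous_integral_pp (hΨ.growth n₀)).const_mul δ)).sub continuous_const
  have hsm : ∀ᶠ m in (l : Filter ℕ), C (x m) (ρ m).1 < ENNReal.ofReal (s (ρ m)) := by
    filter_upwards [hl (eventually_ge_atTop n₀)] with m hm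
    refine (hρ m).trans_le (ENNReal.ofReal_le_ofReal ?_)
    have : ∫ y, Ψ n₀ y ∂(ρ m).1 ≤ ∫ y, Ψ m y ∂(ρ m).1 :=
      integral_mono ((hΨ.growth n₀).integrable_pp hp0 _) ((hΨ.growth m).integrable_pp hp0 _)
        fun y => hΨ.mono y hm
    simp only [hsdef]
    nlinarith
  have hslim : Tendsto (fun m => s (ρ m)) l (𝓝 (s ρ')) := (hscont.tendsto ρ').comp hlim
  have hCle : C x₀ ρ'.1 ≤ ENNReal.ofReal (s ρ') := by
    by_contra! hlt
    obtain ⟨b, hb1, hb2⟩ := exists_between hlt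
    have e1 := hpair.eventually (hlsc (x₀, ρ') b hb2)
    have e2 := (ENNReal.tendsto_ofReal hslim).eventually (gt_mem_nhds hb1)
    obtain ⟨m, h1, h2, h3⟩ := (e1.and (e2.and hsm)).exists
    exact absurd (h1.trans h3) (not_lt.2 h2.le)
  have hs0 : 0 ≤ s ρ' := ge_of_tendsto hslim (hsm.mono fun m hm =>
    (ENNReal.ofReal_pos.1 (pos_of_gt hm)).le)
  have h := (hf ρ').trans hCle
  rw [ENNReal.ofReal_le_ofReal_iff hs0] at h
  simp only [hsdef] at h
  linarith

lemma exists_testFn_minorant (hp : 1 ≤ p) {F : Measure (Rd d) → ℝ≥0∞}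
    (hlsc : LowerSemicontinuous fun ρ : Pp p d => F ρ.1)
    (hconv : ∀ ρ₁ ρ₂ : Pp p d, ∀ t : ℝ≥0∞, t ≤ 1 →
      F (t • ρ₁.1 + (1 - t) • ρ₂.1) ≤ t * F ρ₁.1 + (1 - t) * F ρ₂.1)
    {Ψ : ℕ → Rd d → ℝ} (hΨ : TailDominating p Ψ) {δ : ℝ} (hδ : 0 < δ)
    (ρ₀ : Pp p d) {t : ℝ} (ht : ENNReal.ofReal t < F ρ₀.1) :
    ∃ k r n₀, t - δ < ∫ y, testFn d k r y ∂ρ₀.1 ∧ ∀ ρ : Pp p d,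
      ENNReal.ofReal (∫ y, testFn d k r y ∂ρ.1 - δ * ∫ y, Ψ n₀ y ∂ρ.1 - δ / 2) ≤ F ρ.1 := by
  have hp0 : 0 ≤ p := by linarith
  obtain ⟨f, hf, hfF, hft⟩ := exists_affine_minorant hp0 hlsc hconv ρ₀ ht
  obtain ⟨hfc, K₀, hK₀⟩ := id hf
  set K := |K₀| + 1 with hK
  have hKpos : 0 < K := by positivity
  have hfK : ∀ y, |f y| ≤ K * (1 + ‖y‖ ^ p) := fun y =>
    (hK₀ y).trans (mul_le_mul_of_nonneg_right (by linarith [le_abs_self K₀]) (by positivity))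
  obtain ⟨R₁, n₀, hdom⟩ := hΨ.dominates (8 * K / δ) (by positivity)
  obtain ⟨R₂, hR₂⟩ := exists_integral_tailFn_le hp0 ρ₀ (η := δ / (8 * K)) (by positivity)
  set R := max 0 (max R₁ R₂) with hR
  obtain ⟨k, r, hkr⟩ := exists_testFn_close (p := p) hp hfc hKpos.le hfK
    (R := R) (le_max_left _ _) (ε := δ / 4) (by positivity)
  have hΨR : ∀ y, 4 * K * tailFn p d R y ≤ δ / 2 * Ψ n₀ y := by
    intro y
    have h1 := hdom n₀ le_rfl y
    have h2 := tailFn_anti (p := p) (show R₁ ≤ R from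
      (le_max_left _ _).trans (le_max_right _ _)) y
    have h3 := mul_le_mul_of_nonneg_left h2 (by positivity : (0 : ℝ) ≤ 8 * K / δ)
    have h4 := mul_le_mul_of_nonneg_left (h3.trans h1) (by positivity : (0 : ℝ) ≤ δ / 2)
    have h5 : δ / 2 * (8 * K / δ * tailFn p d R y) = 4 * K * tailFn p d R y := by
      field_simp
      ring
    linarith
  obtain ⟨M, hM⟩ := testFn_bounded (d := d) k r
  have hgG : GrowthP p (testFn d k r) := GrowthP.of_bounded (testFn_continuous k r) hM
  have htG := tailFn_growthP (d := d) hp0 R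
  refine ⟨k, r, n₀, ?_, fun ρ => ?_⟩
  · have h1 : ∫ y, f y ∂ρ₀.1 ≤ ∫ y, (testFn d k r y + (δ / 4 + 4 * K * tailFn p d R y)) ∂ρ₀.1 :=
      integral_mono (hf.integrable_pp hp0 _)
        ((hgG.add ((GrowthP.const _).add (htG.const_mul _))).integrable_pp hp0 _) fun y => by
          have := (abs_le.1 (hkr y)).1
          dsimp only
          linarith
    have := ρ₀.2.1
    rw [integral_add (hgG.integrable_pp hp0 _)
      (((GrowthP.const _).add (htG.const_mul _)).integrable_pp hp0 _),
      integral_add (integrable_const _) ((htG.const_mul _).integrable_pp hp0 _),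
      integral_const_mul] at h1
    simp only [integral_const, probReal_univ, one_smul] at h1
    have h2 : ∫ y, tailFn p d R y ∂ρ₀.1 ≤ ∫ y, tailFn p d R₂ y ∂ρ₀.1 :=
      integral_mono (htG.integrable_pp hp0 _) ((tailFn_growthP hp0 R₂).integrable_pp hp0 _)
        (tailFn_anti ((le_max_right _ _).trans (le_max_right _ _)))
    have h3 := mul_le_mul_of_nonneg_left (h2.trans hR₂) (by positivity : (0 : ℝ) ≤ 4 * K)
    have h4 : 4 * K * (δ / (8 * K)) = δ / 2 := by
      field_simp
      ring
    linarith
  · refine (ENNReal.ofReal_le_ofReal ?_).trans (hfF ρ)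
    have h1 : ∫ y, testFn d k r y ∂ρ.1 ≤ ∫ y, (f y + (δ / 4 + δ / 2 * Ψ n₀ y)) ∂ρ.1 :=
      integral_mono (hgG.integrable_pp hp0 _)
        ((hf.add ((GrowthP.const _).add ((hΨ.growth n₀).const_mul _))).integrable_pp hp0 _)
        fun y => by
          have := (abs_le.1 (hkr y)).2
          dsimp only
          linarith [hΨR y]
    have := ρ.2.1
    rw [integral_add (hf.integrable_pp hp0 _)
      (((GrowthP.const _).add ((hΨ.growth n₀).const_mul _)).integrable_pp hp0 _),
      integral_add (integrable_const _) (((hΨ.growth n₀).const_mul _).integrable_pp hp0 _),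
      integral_const_mul] at h1
    simp only [integral_const, probReal_univ, one_smul] at h1
    have h2 : 0 ≤ ∫ y, Ψ n₀ y ∂ρ.1 := integral_nonneg (hΨ.nonneg n₀)
    nlinarith

/-- A weak transport cost is, up to `δ`, a countable supremum of functions
`(x, ρ) ↦ 1_U(x) ρ(f)` that are dominated by the cost up to a `Ψ`-tail. -/
lemma exists_countable_minorants (hp : 1 ≤ p) {X : Type*} [TopologicalSpace X]
    [SecondCountableTopology X] {C : X → Measure (Rd d) → ℝ≥0∞}
    (hlsc : LowerSemicontinuous fun q : X × Pp p d => C q.1 q.2.1)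
    (hconv : ∀ x : X, ∀ ρ₁ ρ₂ : Pp p d, ∀ t : ℝ≥0∞, t ≤ 1 →
      C x (t • ρ₁.1 + (1 - t) • ρ₂.1) ≤ t * C x ρ₁.1 + (1 - t) * C x ρ₂.1)
    {Ψ : ℕ → Rd d → ℝ} (hΨ : TailDominating p Ψ) {δ : ℝ} (hδ : 0 < δ) :
    ∃ (U : ℕ → Set X) (f : ℕ → Rd d → ℝ) (n : ℕ → ℕ),
      (∀ i, IsOpen (U i)) ∧ (∀ i, Continuous (f i)) ∧ (∀ i, ∃ M, ∀ y, |f i y| ≤ M) ∧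
      U 0 = univ ∧ f 0 = 0 ∧
      (∀ i, ∀ x ∈ U i, ∀ ρ : Pp p d,
        ENNReal.ofReal (∫ y, f i y ∂ρ.1 - δ * ∫ y, Ψ (n i) y ∂ρ.1 - δ) ≤ C x ρ.1) ∧
      ∀ (x : X) (ρ : Pp p d) (t : ℝ), ENNReal.ofReal t < C x ρ.1 →
        ∃ i, x ∈ U i ∧ t - δ < ∫ y, f i y ∂ρ.1 := by
  classical
  have hp0 : 0 ≤ p := by linarith
  let valid : Set X → (Rd d → ℝ) → ℕ → Prop := fun U f n => ∀ x ∈ U, ∀ ρ : Pp p d,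
    ENNReal.ofReal (∫ y, f y ∂ρ.1 - δ * ∫ y, Ψ n y ∂ρ.1 - δ) ≤ C x ρ.1
  have hv0 : valid univ 0 0 := by
    intro x _ ρ
    rw [ENNReal.ofReal_of_nonpos]
    · exact zero_le
    · have h2 : 0 ≤ ∫ y, Ψ 0 y ∂ρ.1 := integral_nonneg (hΨ.nonneg 0)
      simp only [Pi.zero_apply, integral_zero]
      nlinarith
  let B := TopologicalSpace.countableBasis X
  let ι := {q : Option (B × ℕ × ℕ × ℕ) //
    ∀ b, q = some b → valid b.1 (testFn d b.2.1 b.2.2.1) b.2.2.2}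
  let i₀ : ι := ⟨none, by simp⟩
  have : Nonempty ι := ⟨i₀⟩
  have : Countable B := (TopologicalSpace.countable_countableBasis X).to_subtype
  obtain ⟨e, he⟩ := exists_surjective_nat ι
  let U' : ι → Set X := fun q => q.1.elim univ fun b => b.1
  let f' : ι → Rd d → ℝ := fun q => q.1.elim 0 fun b => testFn d b.2.1 b.2.2.1
  let n' : ι → ℕ := fun q => q.1.elim 0 fun b => b.2.2.2
  let e' : ℕ → ι := fun i => Nat.casesOn i i₀ e
  refine ⟨U' ∘ e', f' ∘ e', n' ∘ e', fun i => ?_, fun i => ?_, fun i => ?_, rfl, rfl,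
    fun i => ?_, fun x ρ t ht => ?_⟩
  · change IsOpen (U' (e' i))
    generalize e' i = q
    obtain ⟨_ | b, hq⟩ := q
    · exact isOpen_univ
    · exact TopologicalSpace.isOpen_of_mem_countableBasis b.1.2
  · change Continuous (f' (e' i))
    generalize e' i = q
    obtain ⟨_ | b, hq⟩ := q
    · exact continuous_const
    · exact testFn_continuous _ _
  · change ∃ M, ∀ y, |f' (e' i) y| ≤ M
    generalize e' i = q
    obtain ⟨_ | b, hq⟩ := q
    · exact ⟨0, fun y => by simp [f']⟩
    · exact testFn_bounded _ _
  · change valid (U' (e' i)) (f' (e' i)) (n' (e' i))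
    generalize e' i = q
    obtain ⟨_ | b, hq⟩ := q
    · exact hv0
    · exact hq b rfl
  · obtain ⟨k, r, n₀, h1, h2⟩ := exists_testFn_minorant hp (F := C x)
      (hlsc.comp (Continuous.prodMk_right x)) (hconv x) hΨ hδ ρ ht
    obtain ⟨M, hM⟩ := testFn_bounded (d := d) k r
    obtain ⟨V, hV, n, hVn⟩ := exists_nhds_valid hp hlsc hΨ hδ x (testFn_continuous k r) hM n₀ h2
    obtain ⟨W, hW, hxW, hWV⟩ :=
      (TopologicalSpace.isBasis_countableBasis X).mem_nhds_iff.1 hV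
    obtain ⟨i, hi⟩ := he ⟨some (⟨W, hW⟩, k, r, n), by
      rintro b ⟨⟩
      exact fun x hx => hVn x (hWV hx)⟩
    refine ⟨i + 1, ?_⟩
    change x ∈ U' (e i) ∧ t - δ < ∫ y, f' (e i) y ∂ρ.1
    rw [hi]
    exact ⟨hxW, h1⟩

end Testing

section WeakDuality

variable {d : ℕ} {p : ℝ}

lemma exists_tailDominating (hp : 0 ≤ p) (ν : Pp p d) :
    ∃ Ψ : ℕ → Rd d → ℝ, TailDominating p Ψ ∧ ∀ n, ∫ y, Ψ n y ∂ν.1 ≤ 2 := by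
  choose R hR using fun k : ℕ => exists_integral_tailFn_le hp ν (η := (1 / 2) ^ k) (by positivity)
  refine ⟨fun n y => ∑ k ∈ Finset.range n, tailFn p d (R k) y, ⟨fun n => ?_, fun n y => ?_,
    fun y => ?_, fun a ha => ?_⟩, fun n => ?_⟩
  · exact GrowthP.sum _ fun k _ => tailFn_growthP hp _
  · exact Finset.sum_nonneg fun k _ => tailFn_nonneg _ _
  · intro m n h
    exact Finset.sum_le_sum_of_subset_of_nonneg (by simpa using h)
      fun k _ _ => tailFn_nonneg _ _
  · obtain ⟨m, hm⟩ := exists_nat_ge a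
    refine ⟨∑ k ∈ Finset.range m, |R k|, m, fun n hn y => ?_⟩
    calc a * tailFn p d (∑ k ∈ Finset.range m, |R k|) y
        ≤ m * tailFn p d (∑ k ∈ Finset.range m, |R k|) y :=
          mul_le_mul_of_nonneg_right hm (tailFn_nonneg _ _)
      _ = ∑ k ∈ Finset.range m, tailFn p d (∑ k ∈ Finset.range m, |R k|) y := by simp
      _ ≤ ∑ k ∈ Finset.range m, tailFn p d (R k) y := by
          refine Finset.sum_le_sum fun k hk => tailFn_anti ((le_abs_self _).trans ?_) y
          exact Finset.single_le_sum (f := fun k => |R k|) (fun _ _ => abs_nonneg _) hk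
      _ ≤ _ := Finset.sum_le_sum_of_subset_of_nonneg (by simpa using hn)
          fun k _ _ => tailFn_nonneg _ _
  · rw [integral_finsetSum _ fun k _ => (tailFn_growthP hp _).integrable_pp hp ν]
    exact (Finset.sum_le_sum fun k _ => hR k).trans (sum_geometric_two_le n)

variable {X : Type*} [MeasurableSpace X] {μ : Measure X} {ν : Measure (Rd d)}
  {κ : ProbabilityTheory.Kernel X (Rd d)}

lemma ae_hasMomentP (hκ : μ.bind κ = ν) (hν : HasMomentP p ν) :
    ∀ᵐ x ∂μ, HasMomentP p (κ x) := by
  have hm : Measurable fun y : Rd d => ENNReal.ofReal (‖y‖ ^ p) := by fun_prop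
  have h : ∫⁻ x, ∫⁻ y, ENNReal.ofReal (‖y‖ ^ p) ∂κ x ∂μ ≠ ⊤ := by
    rw [← Measure.lintegral_bind κ.measurable.aemeasurable hm.aemeasurable, hκ]
    exact hν
  exact (ae_lt_top hm.lintegral_kernel h).mono fun x hx => hx.ne

/-- The countable supremum `sup_i 1_{U_i}(x) κ_x(f_i)`, truncated below at `0`. -/
noncomputable def minorantSup (κ : ProbabilityTheory.Kernel X (Rd d)) (U : ℕ → Set X)
    (f : ℕ → Rd d → ℝ) (x : X) : ℝ≥0∞ :=
  ⨆ i, (U i).indicator (fun x => ENNReal.ofReal (∫ y, f i y ∂κ x)) x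

lemma measurable_minorantSup [ProbabilityTheory.IsMarkovKernel κ] {U : ℕ → Set X}
    (hU : ∀ i, MeasurableSet (U i)) {f : ℕ → Rd d → ℝ} (hf : ∀ i, Continuous (f i)) :
    Measurable (minorantSup κ U f) := by
  refine Measurable.iSup fun i => Measurable.indicator ?_ (hU i)
  exact ((hf i).stronglyMeasurable.integral_kernel (κ := κ)).measurable.ennreal_ofReal

lemma le_minorantSup_add {U : ℕ → Set X} {f : ℕ → Rd d → ℝ} {c : ℝ≥0∞} {δ : ℝ} {x : X}
    (h : ∀ t : ℝ, ENNReal.ofReal t < c → ∃ i, x ∈ U i ∧ t - δ < ∫ y, f i y ∂κ x) :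
    c ≤ minorantSup κ U f x + ENNReal.ofReal δ := by
  refine le_of_forall_lt fun a ha => ?_
  obtain ⟨b, hab, hbc⟩ := exists_between ha
  have hb : b ≠ ⊤ := ne_top_of_lt hbc
  obtain ⟨i, hi, hlt⟩ := h b.toReal (by rwa [ENNReal.ofReal_toReal hb])
  refine hab.trans_le ?_
  rw [← ENNReal.ofReal_toReal hb]
  refine (ENNReal.ofReal_le_ofReal (by linarith : b.toReal ≤ ∫ y, f i y ∂κ x + δ)).trans
    (ENNReal.ofReal_add_le.trans ?_)
  gcongr
  refine le_iSup_of_le i ?_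
  rw [indicator_of_mem hi]

lemma aemeasurable_cost [TopologicalSpace X] [SecondCountableTopology X] [BorelSpace X]
    (hp : 1 ≤ p) [IsProbabilityMeasure ν] (hν : HasMomentP p ν)
    [ProbabilityTheory.IsMarkovKernel κ] (hκ : μ.bind κ = ν)
    {C : X → Measure (Rd d) → ℝ≥0∞}
    (hlsc : LowerSemicontinuous fun q : X × Pp p d => C q.1 q.2.1)
    (hconv : ∀ x : X, ∀ ρ₁ ρ₂ : Pp p d, ∀ t : ℝ≥0∞, t ≤ 1 →
      C x (t • ρ₁.1 + (1 - t) • ρ₂.1) ≤ t * C x ρ₁.1 + (1 - t) * C x ρ₂.1) :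
    AEMeasurable (fun x => C x (κ x)) μ := by
  have hp0 : 0 ≤ p := by linarith
  obtain ⟨Ψ, hΨ, hΨν⟩ := exists_tailDominating hp0 (⟨ν, ‹_›, hν⟩ : Pp p d)
  choose U f n hU hf hfb _ _ hval hcov using fun m : ℕ =>
    exists_countable_minorants hp hlsc hconv hΨ (δ := 1 / ((m : ℝ) + 1)) (by positivity)
  have hΨm : ∀ n, Measurable fun y => ENNReal.ofReal (Ψ n y) := fun n =>
    (hΨ.growth n).1.measurable.ennreal_ofReal
  have hT : ∀ᵐ x ∂μ, ∫⁻ y, ⨆ n, ENNReal.ofReal (Ψ n y) ∂κ x < ⊤ := by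
    refine ae_lt_top (Measurable.iSup hΨm).lintegral_kernel ?_
    rw [← Measure.lintegral_bind κ.measurable.aemeasurable (Measurable.iSup hΨm).aemeasurable, hκ,
      lintegral_iSup hΨm fun m n h y => ENNReal.ofReal_le_ofReal (hΨ.mono y h)]
    refine ne_top_of_le_ne_top (ENNReal.ofReal_ne_top (r := 2)) (iSup_le fun n => ?_)
    rw [← ofReal_integral_eq_lintegral_ofReal ((hΨ.growth n).integrable hp0 hν)
      (ae_of_all _ (hΨ.nonneg n))]
    exact ENNReal.ofReal_le_ofReal (hΨν n)
  refine ⟨fun x => ⨅ m : ℕ, (minorantSup κ (U m) (f m) x + ENNReal.ofReal (1 / ((m : ℝ) + 1))),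
    Measurable.iInf fun m => (measurable_minorantSup (fun i => (hU m i).measurableSet)
      (hf m)).add_const _, ?_⟩
  filter_upwards [hT, ae_hasMomentP hκ hν] with x hx hxm
  let ρ : Pp p d := ⟨κ x, inferInstance, hxm⟩
  apply le_antisymm
  · exact le_iInf fun m => le_minorantSup_add fun t ht => hcov m x ρ t ht
  · set T := (∫⁻ y, ⨆ n, ENNReal.ofReal (Ψ n y) ∂κ x).toReal with hTdef
    have hΨT : ∀ n, ∫ y, Ψ n y ∂κ x ≤ T := by
      intro n
      rw [hTdef, integral_eq_lintegral_of_nonneg_ae (ae_of_all _ (hΨ.nonneg n))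
        (hΨ.growth n).1.aestronglyMeasurable]
      exact ENNReal.toReal_mono hx.ne (lintegral_mono fun y => le_iSup
        (fun n => ENNReal.ofReal (Ψ n y)) n)
    have hup : ∀ m : ℕ, minorantSup κ (U m) (f m) x + ENNReal.ofReal (1 / ((m : ℝ) + 1)) ≤
        C x (κ x) + ENNReal.ofReal (1 / ((m : ℝ) + 1) * (T + 2)) := by
      intro m
      have hδ : (0 : ℝ) < 1 / ((m : ℝ) + 1) := by positivity
      have hT0 : 0 ≤ T := ENNReal.toReal_nonneg
      have h1 : minorantSup κ (U m) (f m) x ≤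
          C x (κ x) + ENNReal.ofReal (1 / ((m : ℝ) + 1) * (T + 1)) := by
        refine iSup_le fun i => ?_
        by_cases hi : x ∈ U m i
        · rw [indicator_of_mem hi]
          have h2 := mul_le_mul_of_nonneg_left (hΨT (n m i)) hδ.le
          refine (ENNReal.ofReal_le_ofReal ?_).trans
            (ENNReal.ofReal_add_le.trans (add_le_add_left (hval m i x hi ρ) _))
          dsimp only [ρ]
          linarith
        · rw [indicator_of_notMem hi]
          exact zero_le
      refine (add_le_add_left h1 _).trans (le_of_eq ?_)
      rw [add_assoc, ← ENNReal.ofReal_add (by positivity) hδ.le]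
      ring_nf
    have hlim : Tendsto (fun m : ℕ => C x (κ x) + ENNReal.ofReal (1 / ((m : ℝ) + 1) * (T + 2)))
        atTop (𝓝 (C x (κ x))) := by
      have := (ENNReal.tendsto_ofReal (tendsto_one_div_add_atTop_nhds_zero_nat.mul_const
        (T + 2))).const_add (C x (κ x))
      simpa using this
    exact ge_of_tendsto' hlim fun m => (iInf_le _ m).trans (hup m)

lemma dualVal_le_of_kernel [TopologicalSpace X] [SecondCountableTopology X] [BorelSpace X]
    [IsProbabilityMeasure μ]
    (hp : 1 ≤ p) [IsProbabilityMeasure ν] (hν : HasMomentP p ν)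
    [ProbabilityTheory.IsMarkovKernel κ] (hκ : μ.bind κ = ν)
    {C : X → Measure (Rd d) → ℝ≥0∞}
    (hlsc : LowerSemicontinuous fun q : X × Pp p d => C q.1 q.2.1)
    (hconv : ∀ x : X, ∀ ρ₁ ρ₂ : Pp p d, ∀ t : ℝ≥0∞, t ≤ 1 →
      C x (t • ρ₁.1 + (1 - t) • ρ₂.1) ≤ t * C x ρ₁.1 + (1 - t) * C x ρ₂.1)
    {ψ : Rd d → ℝ} (hψ : Cbp p ψ) :
    dualVal p μ ν C ψ ≤ ((∫⁻ x, C x (κ x) ∂μ : ℝ≥0∞) : EReal) := by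
  have hp0 : 0 ≤ p := by linarith
  have hψG := hψ.growthP hp
  obtain ⟨c', hc'⟩ := hψ.2.1
  obtain ⟨c, hc0, hc⟩ : ∃ c : ℝ, 0 ≤ c ∧ ∀ y, 0 ≤ ψ y + c :=
    ⟨|c'|, abs_nonneg _, fun y => by linarith [hc' y, neg_abs_le c']⟩
  have hw := aemeasurable_cost hp hν hκ hlsc hconv
  set I := ∫⁻ x, C x (κ x) ∂μ with hI
  by_cases hIt : I = ⊤
  · rw [hIt]; exact le_top
  set u : X → ℝ≥0∞ := fun x => erealToENN (conj p C ψ x) with hu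
  set v : X → ℝ≥0∞ := fun x => erealToENN (-conj p C ψ x) with hv
  have hψm : Measurable fun y => ENNReal.ofReal (ψ y + c) :=
    (hψG.1.add continuous_const).measurable.ennreal_ofReal
  set G : X → ℝ≥0∞ := fun x => ∫⁻ y, ENNReal.ofReal (ψ y + c) ∂κ x with hG
  have hGint : ∀ (ρ : Pp p d), ∫⁻ y, ENNReal.ofReal (ψ y + c) ∂ρ.1
      = ENNReal.ofReal (∫ y, ψ y ∂ρ.1 + c) := by
    intro ρ
    have := ρ.2.1
    rw [← ofReal_integral_eq_lintegral_ofReal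
      ((hψG.add (GrowthP.const c)).integrable_pp hp0 ρ) (ae_of_all _ hc),
      integral_add (hψG.integrable_pp hp0 ρ) (integrable_const _)]
    simp
  have hnn : ∀ ρ : Pp p d, 0 ≤ ∫ y, ψ y ∂ρ.1 + c := by
    intro ρ
    have := ρ.2.1
    have h : 0 ≤ ∫ y, (ψ y + c) ∂ρ.1 := integral_nonneg hc
    rw [integral_add (hψG.integrable_pp hp0 ρ) (integrable_const _)] at h
    simpa using h
  have hlow : ∀ x, ((-c : ℝ) : EReal) ≤ conj p C ψ x := by
    refine fun x => le_iInf fun ρ => ?_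
    calc ((-c : ℝ) : EReal) = ((-c : ℝ) : EReal) + 0 := (add_zero _).symm
      _ ≤ _ := add_le_add (EReal.coe_le_coe_iff.2 (by linarith [hnn ρ]))
          (EReal.coe_ennreal_nonneg _)
  have hN : ∫⁻ x, v x ∂μ ≤ ENNReal.ofReal c := by
    refine (lintegral_mono (g := fun _ => ENNReal.ofReal c) fun x => ?_).trans (by simp)
    have h1 : -conj p C ψ x ≤ ((c : ℝ) : EReal) := by
      have := EReal.neg_le_neg_iff.2 (hlow x)
      simpa using this
    simp only [hv, erealToENN]
    rw [if_neg (fun h => by rw [h] at h1; exact absurd h1 (not_le.2 (EReal.coe_lt_top c)))]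
    refine ENNReal.ofReal_le_ofReal ?_
    generalize -conj p C ψ x = z at h1
    induction z with
    | bot => simpa using hc0
    | coe r => exact EReal.coe_le_coe_iff.1 h1
    | top => exact absurd h1 (not_le.2 (EReal.coe_lt_top c))
  have hpt : ∀ᵐ x ∂μ, u x + ENNReal.ofReal c ≤ G x + (C x (κ x) + v x) := by
    filter_upwards [ae_hasMomentP hκ hν] with x hxm
    let ρ : Pp p d := ⟨κ x, inferInstance, hxm⟩
    have h1 : conj p C ψ x ≤ ((∫ y, ψ y ∂κ x : ℝ) : EReal) + ((C x (κ x) : ℝ≥0∞) : EReal) :=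
      iInf_le _ ρ
    have h2 : G x = ENNReal.ofReal (∫ y, ψ y ∂κ x + c) := hGint ρ
    have h3 : 0 ≤ ∫ y, ψ y ∂κ x + c := hnn ρ
    by_cases hCt : C x (κ x) = ⊤
    · simp [hCt]
    have h4 := hlow x
    simp only [hu, hv, erealToENN]
    generalize conj p C ψ x = z at h1 h4
    rw [h2, ← ENNReal.ofReal_toReal hCt]
    rw [← EReal.coe_ennreal_toReal hCt, ← EReal.coe_add] at h1
    have h5 : 0 ≤ (C x (κ x)).toReal := ENNReal.toReal_nonneg
    generalize (C x (κ x)).toReal = w at h1 h5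
    generalize ∫ y, ψ y ∂κ x = s at h1 h3
    induction z with
    | bot => exact absurd h4 (not_le.2 (EReal.bot_lt_coe _))
    | top => exact absurd h1 (not_le.2 (EReal.coe_lt_top _))
    | coe r =>
      have h6 : r ≤ s + w := EReal.coe_le_coe_iff.1 h1
      rw [if_neg (EReal.coe_ne_top r), ← EReal.coe_neg, if_neg (EReal.coe_ne_top _),
        EReal.toReal_coe, EReal.toReal_coe]
      rcases le_total 0 r with hr | hr
      · rw [ENNReal.ofReal_of_nonpos (by linarith : -r ≤ 0), add_zero,
          ← ENNReal.ofReal_add hr hc0, ← ENNReal.ofReal_add h3 h5]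
        exact ENNReal.ofReal_le_ofReal (by linarith)
      · rw [ENNReal.ofReal_of_nonpos hr, zero_add, ← ENNReal.ofReal_add h5 (by linarith),
          ← ENNReal.ofReal_add h3 (by linarith)]
        exact ENNReal.ofReal_le_ofReal (by linarith)
  have hmain : ∫⁻ x, u x ∂μ + ENNReal.ofReal c
      ≤ ENNReal.ofReal (∫ y, ψ y ∂ν + c) + (I + ∫⁻ x, v x ∂μ) := by
    calc ∫⁻ x, u x ∂μ + ENNReal.ofReal c = ∫⁻ x, (u x + ENNReal.ofReal c) ∂μ := by
          rw [lintegral_add_right _ measurable_const]; simp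
      _ ≤ ∫⁻ x, (G x + (C x (κ x) + v x)) ∂μ := lintegral_mono_ae hpt
      _ = ∫⁻ x, G x ∂μ + (I + ∫⁻ x, v x ∂μ) := by
          rw [lintegral_add_left hψm.lintegral_kernel, lintegral_add_left' hw]
      _ = _ := by
          rw [hG, ← Measure.lintegral_bind κ.measurable.aemeasurable hψm.aemeasurable, hκ,
            ← hGint ⟨ν, ‹_›, hν⟩]
  have hNt : ∫⁻ x, v x ∂μ ≠ ⊤ := ne_top_of_le_ne_top ENNReal.ofReal_ne_top hN
  have hPt : ∫⁻ x, u x ∂μ ≠ ⊤ := by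
    refine ne_top_of_le_ne_top ?_ (le_self_add.trans hmain)
    exact ENNReal.add_ne_top.2 ⟨ENNReal.ofReal_ne_top, ENNReal.add_ne_top.2 ⟨hIt, hNt⟩⟩
  change ((∫⁻ x, u x ∂μ : ℝ≥0∞) : EReal) - ((∫⁻ x, v x ∂μ : ℝ≥0∞) : EReal)
    - ((∫ y, ψ y ∂ν : ℝ) : EReal) ≤ (I : EReal)
  have h3 := hnn ⟨ν, ‹_›, hν⟩
  dsimp only at h3
  generalize ∫⁻ x, u x ∂μ = P at *
  generalize ∫⁻ x, v x ∂μ = N at *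
  clear_value I
  lift P to NNReal using hPt
  lift N to NNReal using hNt
  lift I to NNReal using hIt
  generalize ∫ y, ψ y ∂ν = s at *
  have h4 : (P : ℝ) + c ≤ (s + c) + (I + N) := by
    have h := ENNReal.toReal_mono (by finiteness) hmain
    rw [ENNReal.toReal_add (by finiteness) (by finiteness),
      ENNReal.toReal_add (by finiteness) (by finiteness),
      ENNReal.toReal_add (by finiteness) (by finiteness),
      ENNReal.toReal_ofReal hc0, ENNReal.toReal_ofReal h3] at h
    simpa using h
  simp only [EReal.coe_nnreal_eq_coe_real, ← EReal.coe_sub]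
  exact EReal.coe_le_coe_iff.2 (by linarith)

lemma dualVal_le_primal [TopologicalSpace X] [SecondCountableTopology X] [BorelSpace X]
    [IsProbabilityMeasure μ] (hp : 1 ≤ p) [IsProbabilityMeasure ν] (hν : HasMomentP p ν)
    {C : X → Measure (Rd d) → ℝ≥0∞}
    (hlsc : LowerSemicontinuous fun q : X × Pp p d => C q.1 q.2.1)
    (hconv : ∀ x : X, ∀ ρ₁ ρ₂ : Pp p d, ∀ t : ℝ≥0∞, t ≤ 1 →
      C x (t • ρ₁.1 + (1 - t) • ρ₂.1) ≤ t * C x ρ₁.1 + (1 - t) * C x ρ₂.1)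
    {ψ : Rd d → ℝ} (hψ : Cbp p ψ) :
    dualVal p μ ν C ψ ≤ ((primal μ ν C : ℝ≥0∞) : EReal) := by
  have hmap := (Monotone.map_iInf_of_continuousAt (ι := {π : Measure (X × Rd d) //
    IsCoupling π μ ν}) (g := fun π => ∫⁻ x, C x (disint π.1 x) ∂μ)
    (f := ((↑) : ℝ≥0∞ → EReal)) continuous_coe_ennreal_ereal.continuousAt
    EReal.coe_ennreal_strictMono.monotone (by simp))
  rw [primal, hmap]
  refine le_iInf fun ⟨π, hπ, hfst, hsnd⟩ => ?_
  have hd : disint π = π.condKernel := by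
    rw [disint, dif_pos (inferInstance : IsFiniteMeasure π)]
  change _ ≤ ((∫⁻ x, C x (disint π x) ∂μ : ℝ≥0∞) : EReal)
  rw [hd]
  refine dualVal_le_of_kernel hp hν ?_ hlsc hconv hψ
  rw [← hfst, ← hsnd]
  change _ = π.snd
  conv_rhs => rw [← π.disintegrate π.condKernel]
  rw [Measure.snd_compProd]
  rfl

end WeakDuality

section Envelope

variable {d : ℕ} {p : ℝ}

/-- `m` is a boundedly supported probability measure with barycenter `y`. -/
structure IsSpread {d : ℕ} (y : Rd d) (R : ℝ) (m : Measure (Rd d)) : Prop where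
  prob : IsProbabilityMeasure m
  bdd : ∀ᵐ z ∂m, z ∈ Metric.closedBall y R
  mean : ∫ z, z ∂m = y

lemma integrable_of_ae_mem_closedBall {E F : Type*} [NormedAddCommGroup E] [ProperSpace E]
    [MeasurableSpace E] [BorelSpace E] [NormedAddCommGroup F] {m : Measure E}
    [IsFiniteMeasure m] {y : E} {R : ℝ}
    (h : ∀ᵐ z ∂m, z ∈ Metric.closedBall y R) {f : E → F} (hf : Continuous f) :
    Integrable f m := by
  have := hf.continuousOn.integrableOn_compact (μ := m) (isCompact_closedBall y R)
  rwa [IntegrableOn, Measure.restrict_eq_self_of_ae_mem h] at this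

lemma IsSpread.integrable {F : Type*} [NormedAddCommGroup F] {y : Rd d} {R : ℝ}
    {m : Measure (Rd d)} (h : IsSpread y R m) {f : Rd d → F} (hf : Continuous f) :
    Integrable f m := by
  have := h.prob
  exact integrable_of_ae_mem_closedBall h.bdd hf

lemma isSpread_dirac (y : Rd d) {R : ℝ} (hR : 0 ≤ R) : IsSpread y R (Measure.dirac y) where
  prob := inferInstance
  bdd := (ae_dirac_iff Metric.isClosed_closedBall.measurableSet).2 (by simpa using hR)
  mean := by simp

lemma IsSpread.mono {y : Rd d} {R R' : ℝ} (hR : R ≤ R') {m : Measure (Rd d)}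
    (h : IsSpread y R m) : IsSpread y R' m :=
  ⟨h.prob, h.bdd.mono fun _ hz => Metric.closedBall_subset_closedBall hR hz, h.mean⟩

lemma IsSpread.translate {y : Rd d} {R : ℝ} {m : Measure (Rd d)} (h : IsSpread y R m)
    (v : Rd d) : IsSpread (y + v) R (m.map fun z => z + v) where
  prob := by
    have := h.prob
    exact Measure.isProbabilityMeasure_map (by fun_prop)
  bdd := by
    refine (ae_map_iff (p := fun z => z ∈ Metric.closedBall (y + v) R) (by fun_prop)
      Metric.isClosed_closedBall.measurableSet).2 ?_
    filter_upwards [h.bdd] with z hz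
    simpa [dist_eq_norm] using hz
  mean := by
    have := h.prob
    rw [integral_map (by fun_prop) (by fun_prop),
      integral_add (h.integrable continuous_id') (integrable_const _), h.mean]
    simp

lemma IsSpread.mix {y₁ y₂ : Rd d} {R₁ R₂ : ℝ} {m₁ m₂ : Measure (Rd d)} (h₁ : IsSpread y₁ R₁ m₁)
    (h₂ : IsSpread y₂ R₂ m₂) {a b : ℝ} (ha : 0 ≤ a) (hb : 0 ≤ b) (hab : a + b = 1) :
    ∃ R m, IsSpread (a • y₁ + b • y₂) R m ∧ ∀ ψ : Rd d → ℝ, Continuous ψ →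
      ∫ z, ψ z ∂m = a * ∫ z, ψ z ∂m₁ + b * ∫ z, ψ z ∂m₂ := by
  have := h₁.prob
  have := h₂.prob
  have key : ∀ {F : Type} [NormedAddCommGroup F] [NormedSpace ℝ F] (f : Rd d → F), Continuous f →
      ∫ z, f z ∂(ENNReal.ofReal a • m₁ + ENNReal.ofReal b • m₂)
        = a • ∫ z, f z ∂m₁ + b • ∫ z, f z ∂m₂ := by
    intro F _ _ f hf
    rw [integral_add_measure ((h₁.integrable hf).smul_measure ENNReal.ofReal_ne_top)
      ((h₂.integrable hf).smul_measure ENNReal.ofReal_ne_top), integral_smul_measure,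
      integral_smul_measure, ENNReal.toReal_ofReal ha, ENNReal.toReal_ofReal hb]
  set y := a • y₁ + b • y₂
  refine ⟨max (R₁ + dist y₁ y) (R₂ + dist y₂ y),
    ENNReal.ofReal a • m₁ + ENNReal.ofReal b • m₂, ⟨⟨?_⟩, ?_, ?_⟩, fun ψ hψ => key ψ hψ⟩
  · simp [← ENNReal.ofReal_add ha hb, hab]
  · rw [ae_add_measure_iff]
    refine ⟨Measure.ae_smul_measure (h₁.bdd.mono fun z hz => ?_) _,
      Measure.ae_smul_measure (h₂.bdd.mono fun z hz => ?_) _⟩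
    · exact Metric.closedBall_subset_closedBall (le_max_left _ _)
        (Metric.closedBall_subset_closedBall' le_rfl hz)
    · exact Metric.closedBall_subset_closedBall (le_max_right _ _)
        (Metric.closedBall_subset_closedBall' le_rfl hz)
  · rw [key _ continuous_id', h₁.mean, h₂.mean]

/-- The convex envelope of `ψ`. -/
noncomputable def convexEnv (ψ : Rd d → ℝ) (y : Rd d) : ℝ :=
  ⨅ q : {q : ℝ × Measure (Rd d) // IsSpread y q.1 q.2}, ∫ z, ψ z ∂q.1.2

variable {ψ : Rd d → ℝ} {c : ℝ}

lemma le_integral_of_isSpread (hψ : Continuous ψ) (hc : ∀ y, c ≤ ψ y) {y : Rd d} {R : ℝ}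
    {m : Measure (Rd d)} (h : IsSpread y R m) : c ≤ ∫ z, ψ z ∂m := by
  have := h.prob
  calc c = ∫ _, c ∂m := by simp
    _ ≤ _ := integral_mono (integrable_const _) (h.integrable hψ) hc

lemma convexEnv_le_integral (hψ : Continuous ψ) (hc : ∀ y, c ≤ ψ y) {y : Rd d} {R : ℝ}
    {m : Measure (Rd d)} (h : IsSpread y R m) : convexEnv ψ y ≤ ∫ z, ψ z ∂m :=
  ciInf_le (f := fun q : {q : ℝ × Measure (Rd d) // IsSpread y q.1 q.2} => ∫ z, ψ z ∂q.1.2)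
    ⟨c, by rintro _ ⟨q, rfl⟩; exact le_integral_of_isSpread hψ hc q.2⟩ ⟨(R, m), h⟩

lemma convexEnv_le (hψ : Continuous ψ) (hc : ∀ y, c ≤ ψ y) (y : Rd d) : convexEnv ψ y ≤ ψ y := by
  simpa using convexEnv_le_integral hψ hc (isSpread_dirac y le_rfl)

lemma nonempty_isSpread (y : Rd d) :
    Nonempty {q : ℝ × Measure (Rd d) // IsSpread y q.1 q.2} :=
  ⟨⟨(0, Measure.dirac y), isSpread_dirac y le_rfl⟩⟩

lemma le_convexEnv (hψ : Continuous ψ) (hc : ∀ y, c ≤ ψ y) (y : Rd d) : c ≤ convexEnv ψ y := by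
  have := nonempty_isSpread y
  exact le_ciInf fun q => le_integral_of_isSpread hψ hc q.2

lemma exists_isSpread_lt (ψ : Rd d → ℝ) (y : Rd d) {ε : ℝ} (hε : 0 < ε) :
    ∃ R m, IsSpread y R m ∧ ∫ z, ψ z ∂m < convexEnv ψ y + ε := by
  have := nonempty_isSpread y
  obtain ⟨⟨q, hq⟩, h⟩ := exists_lt_of_ciInf_lt
    (lt_add_of_pos_right (convexEnv ψ y) hε)
  exact ⟨q.1, q.2, hq, h⟩

lemma convexOn_convexEnv (hψ : Continuous ψ) (hc : ∀ y, c ≤ ψ y) :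
    ConvexOn ℝ univ (convexEnv ψ) := by
  refine ⟨convex_univ, fun y₁ _ y₂ _ a b ha hb hab => ?_⟩
  refine le_of_forall_pos_le_add fun ε hε => ?_
  obtain ⟨R₁, m₁, h₁, e₁⟩ := exists_isSpread_lt ψ y₁ hε
  obtain ⟨R₂, m₂, h₂, e₂⟩ := exists_isSpread_lt ψ y₂ hε
  obtain ⟨R, m, h, hm⟩ := h₁.mix h₂ ha hb hab
  have h3 := convexEnv_le_integral hψ hc h
  rw [hm ψ hψ] at h3
  have e3 := mul_le_mul_of_nonneg_left e₁.le ha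
  have e4 := mul_le_mul_of_nonneg_left e₂.le hb
  simp only [smul_eq_mul]
  have : a * ε + b * ε = ε := by rw [← add_mul, hab, one_mul]
  linarith

lemma continuous_convexEnv (hψ : Continuous ψ) (hc : ∀ y, c ≤ ψ y) :
    Continuous (convexEnv ψ) :=
  continuousOn_univ.1 ((convexOn_convexEnv hψ hc).continuousOn isOpen_univ)

lemma cbp_convexEnv (hψ : Cbp p ψ) : Cbp p (convexEnv ψ) := by
  obtain ⟨hψc, ⟨c, hc⟩, K, hK, y₀, h⟩ := hψ
  exact ⟨continuous_convexEnv hψc hc, ⟨c, le_convexEnv hψc hc⟩, K, hK, y₀, fun y =>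
    (convexEnv_le hψc hc y).trans (h y)⟩

/-- The kernel `y ↦ m(· - y)` of translates of `m`. -/
noncomputable def translateKernel (m : Measure (Rd d)) [SFinite m] (y₀ : Rd d) :
    ProbabilityTheory.Kernel (Rd d) (Rd d) where
  toFun y := m.map fun z => z + (y - y₀)
  measurable' := by
    refine Measure.measurable_of_measurable_coe _ fun s hs => ?_
    have h : ∀ y, m.map (fun z => z + (y - y₀)) s
        = m (Prod.mk y ⁻¹' ((fun q : Rd d × Rd d => q.2 + (q.1 - y₀)) ⁻¹' s)) := fun y => by
      rw [Measure.map_apply (by fun_prop) hs]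
      rfl
    simp_rw [h]
    exact measurable_measure_prodMk_left ((by fun_prop :
      Measurable fun q : Rd d × Rd d => q.2 + (q.1 - y₀)) hs)

lemma continuous_integral_translate (hψ : Continuous ψ) {y₀ : Rd d} {R : ℝ} {m : Measure (Rd d)}
    (h : IsSpread y₀ R m) :
    Continuous fun y => ∫ z, ψ z ∂(m.map fun z => z + (y - y₀)) := by
  have := h.prob
  have h1 := continuous_parametric_integral_of_continuous (μ := m)
    (f := fun y z => ψ (z + (y - y₀))) (by
      unfold Function.uncurry
      fun_prop) (isCompact_closedBall y₀ R)
  rw [Measure.restrict_eq_self_of_ae_mem h.bdd] at h1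
  convert h1 using 2 with y
  rw [integral_map (by fun_prop) (by fun_prop)]

/-- A kernel spreading each point around itself, with uniformly bounded support. -/
def IsDilation (κ : ProbabilityTheory.Kernel (Rd d) (Rd d)) (R : ℝ) : Prop :=
  ∀ y, IsSpread y R (κ y)

lemma exists_dilation_of_isCompact (hψ : Continuous ψ) (hc : ∀ y, c ≤ ψ y) {S : Set (Rd d)}
    (hS : IsCompact S) {ε : ℝ} (hε : 0 < ε) :
    ∃ κ R, IsDilation κ R ∧ (∀ y, ∫ z, ψ z ∂κ y ≤ ψ y) ∧
      ∀ y ∈ S, ∫ z, ψ z ∂κ y ≤ convexEnv ψ y + ε := by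
  classical
  have hid : IsDilation (ProbabilityTheory.Kernel.id (α := Rd d)) 0 := fun y => by
    rw [ProbabilityTheory.Kernel.id_apply]
    exact isSpread_dirac y le_rfl
  have hidψ : ∀ y, ∫ z, ψ z ∂(ProbabilityTheory.Kernel.id (α := Rd d) y) = ψ y := fun y => by
    rw [ProbabilityTheory.Kernel.id_apply, integral_dirac]
  refine hS.induction_on ?_ ?_ ?_ ?_
  · exact ⟨_, 0, hid, fun y => (hidψ y).le, fun y hy => absurd hy (notMem_empty y)⟩
  · rintro s t hst ⟨κ, R, h1, h2, h3⟩
    exact ⟨κ, R, h1, h2, fun y hy => h3 y (hst hy)⟩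
  · rintro s t ⟨κ, R, h1, h2, h3⟩ ⟨κ', R', h1', h2', h3'⟩
    have hA : MeasurableSet {y | ∫ z, ψ z ∂κ y ≤ ∫ z, ψ z ∂κ' y} :=
      measurableSet_le (hψ.stronglyMeasurable.integral_kernel).measurable
        (hψ.stronglyMeasurable.integral_kernel).measurable
    have hmin : ∀ y, ∫ z, ψ z ∂(ProbabilityTheory.Kernel.piecewise hA κ κ' y)
        = min (∫ z, ψ z ∂κ y) (∫ z, ψ z ∂κ' y) := by
      intro y
      rw [ProbabilityTheory.Kernel.piecewise_apply]
      split_ifs with h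
      · exact (min_eq_left h).symm
      · exact (min_eq_right (not_le.1 h).le).symm
    refine ⟨ProbabilityTheory.Kernel.piecewise hA κ κ', max R R', fun y => ?_, fun y => ?_, ?_⟩
    · rw [ProbabilityTheory.Kernel.piecewise_apply]
      split_ifs
      · exact (h1 y).mono (le_max_left _ _)
      · exact (h1' y).mono (le_max_right _ _)
    · rw [hmin]
      exact (min_le_left _ _).trans (h2 y)
    · rintro y (hy | hy) <;> rw [hmin]
      · exact (min_le_left _ _).trans (h3 y hy)
      · exact (min_le_right _ _).trans (h3' y hy)
  · intro y₀ _
    obtain ⟨R, m, hm, hlt⟩ := exists_isSpread_lt ψ y₀ hε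
    have := hm.prob
    have hcont := continuous_integral_translate hψ hm
    have hU : IsOpen {y | ∫ z, ψ z ∂(m.map fun z => z + (y - y₀)) < convexEnv ψ y + ε} :=
      isOpen_lt hcont ((continuous_convexEnv hψ hc).add continuous_const)
    have hA : MeasurableSet {y | ∫ z, ψ z ∂(m.map fun z => z + (y - y₀)) ≤ ψ y} :=
      (isClosed_le hcont hψ).measurableSet
    refine ⟨_, mem_nhdsWithin_of_mem_nhds (hU.mem_nhds (by simpa using hlt)),
      ProbabilityTheory.Kernel.piecewise hA (translateKernel m y₀) ProbabilityTheory.Kernel.id,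
      max R 0, fun y => ?_, fun y => ?_, fun y hy => ?_⟩
    · rw [ProbabilityTheory.Kernel.piecewise_apply]
      split_ifs
      · have h := (hm.translate (y - y₀)).mono (le_max_left R 0)
        rwa [add_sub_cancel] at h
      · exact (hid y).mono (le_max_right _ _)
    · rw [ProbabilityTheory.Kernel.piecewise_apply]
      split_ifs with h
      · exact h
      · exact (hidψ y).le
    · have hy : ∫ z, ψ z ∂(m.map fun z => z + (y - y₀)) < convexEnv ψ y + ε := hy
      rw [ProbabilityTheory.Kernel.piecewise_apply]
      split_ifs with h
      · exact hy.le
      · rw [hidψ]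
        exact (not_le.1 h).le.trans (le_of_lt hy)

end Envelope

section ConvexOrder

variable {d : ℕ} {p : ℝ}

lemma EReal.coe_sub_coe_le {a a' b b' : ℝ≥0∞} (ha' : a' ≠ ⊤) (hb' : b' ≠ ⊤)
    (h : a + b' ≤ b + a') : (a : EReal) - (a' : EReal) ≤ (b : EReal) - (b' : EReal) := by
  lift a' to NNReal using ha'
  lift b' to NNReal using hb'
  induction b with
  | top =>
    rw [EReal.coe_ennreal_top, EReal.coe_nnreal_eq_coe_real b', EReal.top_sub_coe]
    exact le_top
  | coe b =>
    have ha : a ≠ ⊤ := ne_top_of_le_ne_top (by finiteness) (le_self_add.trans h)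
    lift a to NNReal using ha
    have h' : (a : ℝ) + b' ≤ b + a' := by exact_mod_cast h
    simp only [EReal.coe_nnreal_eq_coe_real, ← EReal.coe_sub]
    exact EReal.coe_le_coe_iff.2 (by linarith)

lemma eInt_coe {α : Type*} [MeasurableSpace α] (m : Measure α) (f : α → ℝ) :
    eInt m (fun y => (f y : EReal))
      = ((∫⁻ y, ENNReal.ofReal (f y) ∂m : ℝ≥0∞) : EReal)
        - ((∫⁻ y, ENNReal.ofReal (-f y) ∂m : ℝ≥0∞) : EReal) := by
  simp only [eInt, erealToENN, ← EReal.coe_neg, EReal.coe_ne_top, if_false, EReal.toReal_coe]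

lemma integral_le_eInt {α : Type*} [MeasurableSpace α] {m : Measure α} {f : α → ℝ}
    (hf : Integrable f m) {g : α → EReal} (hfg : ∀ x, (f x : EReal) ≤ g x) :
    ((∫ x, f x ∂m : ℝ) : EReal) ≤ eInt m g := by
  have h1 : ∀ x, ENNReal.ofReal (f x) ≤ erealToENN (g x) := fun x => by
    have := hfg x
    unfold erealToENN
    split_ifs with h
    · exact le_top
    · generalize g x = z at *
      induction z with
      | bot => exact absurd this (not_le.2 (EReal.bot_lt_coe _))
      | top => exact absurd rfl h
      | coe r => exact ENNReal.ofReal_le_ofReal (EReal.coe_le_coe_iff.1 this)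
  have h2 : ∀ x, erealToENN (-g x) ≤ ENNReal.ofReal (-f x) := fun x => by
    have := hfg x
    unfold erealToENN
    generalize g x = z at *
    induction z with
    | bot => exact absurd this (not_le.2 (EReal.bot_lt_coe _))
    | top => simp
    | coe r =>
      rw [← EReal.coe_neg, if_neg (EReal.coe_ne_top _), EReal.toReal_coe]
      exact ENNReal.ofReal_le_ofReal (neg_le_neg (EReal.coe_le_coe_iff.1 this))
  have hp : ∫⁻ x, ENNReal.ofReal (f x) ∂m ≠ ⊤ := hf.lintegral_lt_top.ne
  have hn : ∫⁻ x, ENNReal.ofReal (-f x) ∂m ≠ ⊤ := hf.neg.lintegral_lt_top.ne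
  have heq : ((∫ x, f x ∂m : ℝ) : EReal) = ((∫⁻ x, ENNReal.ofReal (f x) ∂m : ℝ≥0∞) : EReal)
      - ((∫⁻ x, ENNReal.ofReal (-f x) ∂m : ℝ≥0∞) : EReal) := by
    rw [integral_eq_lintegral_pos_part_sub_lintegral_neg_part hf, EReal.coe_sub,
      EReal.coe_ennreal_toReal hp, EReal.coe_ennreal_toReal hn]
  rw [heq]
  exact EReal.coe_sub_coe_le hn (ne_top_of_le_ne_top hn (lintegral_mono h2))
    (add_le_add (lintegral_mono h1) (lintegral_mono h2))

lemma ConvexOn.exists_linear_growth_lower {f : Rd d → ℝ} (hf : ConvexOn ℝ univ f) :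
    ∃ K : ℝ, ∀ y, -f y ≤ K * (1 + ‖y‖) := by
  have hfc : Continuous f := continuousOn_univ.1 (hf.continuousOn isOpen_univ)
  obtain ⟨M, hM⟩ := (isCompact_closedBall (0 : Rd d) 1).exists_bound_of_continuousOn
    hfc.continuousOn
  have h0 := hM 0 (by simp)
  rw [Real.norm_eq_abs] at h0
  refine ⟨|M| + |M|, fun y => ?_⟩
  have hu : ‖(-(‖y‖⁻¹)) • y‖ ≤ 1 := by
    rw [norm_smul, norm_neg, norm_inv, norm_norm]
    exact inv_mul_le_one
  have h1 := hM ((-(‖y‖⁻¹)) • y) (by simpa using hu)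
  rw [Real.norm_eq_abs] at h1
  have hn := norm_nonneg y
  have hpos : 0 < 1 + ‖y‖ := by positivity
  have h2 := hf.2 (mem_univ y) (mem_univ ((-(‖y‖⁻¹)) • y))
    (by positivity : 0 ≤ 1 / (1 + ‖y‖)) (by positivity : 0 ≤ ‖y‖ / (1 + ‖y‖)) (by field_simp)
  have h3 : (1 / (1 + ‖y‖)) • y + (‖y‖ / (1 + ‖y‖)) • ((-(‖y‖⁻¹)) • y) = 0 := by
    rw [smul_smul, ← add_smul]
    by_cases hy : y = 0
    · simp [hy]
    · have : ‖y‖ ≠ 0 := by simpa using hy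
      have e : 1 / (1 + ‖y‖) + ‖y‖ / (1 + ‖y‖) * (-(‖y‖⁻¹)) = 0 := by
        field_simp
        ring
      rw [e, zero_smul]
  rw [h3, smul_eq_mul, smul_eq_mul, div_mul_eq_mul_div, div_mul_eq_mul_div, one_mul, ← add_div,
    le_div_iff₀ hpos] at h2
  have e1 : -|M| ≤ f 0 := by linarith [neg_abs_le (f 0), le_abs_self M]
  have e2 : f ((-(‖y‖⁻¹)) • y) ≤ |M| := (le_abs_self _).trans (h1.trans (le_abs_self M))
  nlinarith [mul_le_mul_of_nonneg_left e2 hn, abs_nonneg M]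

lemma ConvexOn.lintegral_neg_ne_top (hp : 1 ≤ p) {f : Rd d → ℝ} (hf : ConvexOn ℝ univ f)
    (ρ : Pp p d) : ∫⁻ y, ENNReal.ofReal (-f y) ∂ρ.1 ≠ ⊤ := by
  obtain ⟨K, hK⟩ := hf.exists_linear_growth_lower
  have hG : GrowthP p fun y : Rd d => K * (1 + ‖y‖) := by
    refine ⟨by fun_prop, |K| * 2, fun y => ?_⟩
    rw [abs_mul, mul_assoc, abs_of_nonneg (by positivity : 0 ≤ 1 + ‖y‖)]
    refine mul_le_mul_of_nonneg_left ?_ (abs_nonneg K)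
    rcases le_total ‖y‖ 1 with h | h
    · have : (0 : ℝ) ≤ ‖y‖ ^ p := by positivity
      linarith
    · have e2 : ‖y‖ ≤ ‖y‖ ^ p := by
        conv_lhs => rw [← Real.rpow_one ‖y‖]
        exact Real.rpow_le_rpow_of_exponent_le h hp
      linarith [norm_nonneg y]
  refine ne_top_of_le_ne_top ?_ (lintegral_mono fun y => ENNReal.ofReal_le_ofReal (hK y))
  exact (hG.integrable_pp (by linarith) ρ).lintegral_lt_top.ne

lemma IsDilation.convexOrder (hp : 1 ≤ p) {κ : ProbabilityTheory.Kernel (Rd d) (Rd d)} {R : ℝ}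
    (hκ : IsDilation κ R) (ρ ρ' : Pp p d) (hρ : ρ.1.bind κ = ρ'.1) :
    ConvexOrder ρ.1 ρ'.1 := by
  intro f hf
  have hfc : Continuous f := continuousOn_univ.1 (hf.continuousOn isOpen_univ)
  have hm1 : Measurable fun y => ENNReal.ofReal (f y) := hfc.measurable.ennreal_ofReal
  have hm2 : Measurable fun y => ENNReal.ofReal (-f y) := hfc.neg.measurable.ennreal_ofReal
  rw [eInt_coe, eInt_coe]
  refine EReal.coe_sub_coe_le (hf.lintegral_neg_ne_top hp ρ) (hf.lintegral_neg_ne_top hp ρ') ?_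
  rw [← hρ, Measure.lintegral_bind κ.measurable.aemeasurable hm1.aemeasurable,
    Measure.lintegral_bind κ.measurable.aemeasurable hm2.aemeasurable,
    ← lintegral_add_left hm1, ← lintegral_add_right _ hm2]
  refine lintegral_mono fun y => ?_
  have := (hκ y).prob
  have h_int := (hκ y).integrable hfc
  have hj : f y ≤ ∫ z, f z ∂κ y := by
    have := hf.map_integral_le hfc.continuousOn isClosed_univ (ae_of_all _ fun _ => mem_univ _)
      ((hκ y).integrable continuous_id') h_int
    rwa [(hκ y).mean] at this
  have e1 : ∫⁻ z, ENNReal.ofReal (f z) ∂κ y ≠ ⊤ := h_int.lintegral_lt_top.ne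
  have e2 : ∫⁻ z, ENNReal.ofReal (-f z) ∂κ y ≠ ⊤ := h_int.neg.lintegral_lt_top.ne
  rw [integral_eq_lintegral_pos_part_sub_lintegral_neg_part h_int] at hj
  generalize ∫⁻ z, ENNReal.ofReal (f z) ∂κ y = A at *
  generalize ∫⁻ z, ENNReal.ofReal (-f z) ∂κ y = B at *
  change ENNReal.ofReal (f y) + B ≤ A + ENNReal.ofReal (-f y)
  rw [← ENNReal.ofReal_toReal e1, ← ENNReal.ofReal_toReal e2]
  have hA := ENNReal.toReal_nonneg (a := A)
  have hB := ENNReal.toReal_nonneg (a := B)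
  rcases le_total 0 (f y) with h | h
  · rw [ENNReal.ofReal_of_nonpos (by linarith : -f y ≤ 0), add_zero, ← ENNReal.ofReal_add h hB]
    exact ENNReal.ofReal_le_ofReal (by linarith)
  · rw [ENNReal.ofReal_of_nonpos h, zero_add, ← ENNReal.ofReal_add hA (by linarith)]
    exact ENNReal.ofReal_le_ofReal (by linarith)

lemma IsDilation.hasMomentP_bind (hp : 1 ≤ p) {κ : ProbabilityTheory.Kernel (Rd d) (Rd d)}
    {R : ℝ} (hR : 0 ≤ R) (hκ : IsDilation κ R) (ρ : Pp p d) : HasMomentP p (ρ.1.bind κ) := by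
  have hp0 : 0 ≤ p := by linarith
  have hm : Measurable fun y : Rd d => ENNReal.ofReal (‖y‖ ^ p) := by fun_prop
  unfold HasMomentP
  rw [Measure.lintegral_bind κ.measurable.aemeasurable hm.aemeasurable]
  have hG : GrowthP p fun y : Rd d => 2 ^ (p - 1) * (‖y‖ ^ p + R ^ p) := by
    refine GrowthP.const_mul (GrowthP.add ⟨continuous_norm_rpow hp0, 1, fun y => ?_⟩
      (GrowthP.const _)) _
    have h : (0 : ℝ) ≤ ‖y‖ ^ p := by positivity
    rw [abs_of_nonneg h]
    linarith
  refine ne_top_of_le_ne_top (hG.integrable_pp hp0 ρ).lintegral_lt_top.ne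
    (lintegral_mono fun y => ?_)
  have := (hκ y).prob
  refine (lintegral_mono_ae ((hκ y).bdd.mono fun z hz => ENNReal.ofReal_le_ofReal
    (?_ : ‖z‖ ^ p ≤ 2 ^ (p - 1) * (‖y‖ ^ p + R ^ p)))).trans (by simp)
  refine (Real.rpow_le_rpow (norm_nonneg _) ?_ hp0).trans
    (add_rpow_le_two_rpow hp (norm_nonneg y) hR)
  rw [Metric.mem_closedBall, dist_eq_norm] at hz
  calc ‖z‖ = ‖y + (z - y)‖ := by congr 1; abel
    _ ≤ _ := (norm_add_le _ _).trans (by linarith)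

/-- The convex envelope is attained approximately along the convex order. -/
lemma exists_convexOrder_integral_le (hp : 1 ≤ p) {ψ : Rd d → ℝ} (hψ : Cbp p ψ) (ρ : Pp p d)
    {ε : ℝ} (hε : 0 < ε) :
    ∃ ρ' : Pp p d, ConvexOrder ρ.1 ρ'.1 ∧
      ∫ y, ψ y ∂ρ'.1 ≤ ∫ y, convexEnv ψ y ∂ρ.1 + ε := by
  have hp0 : 0 ≤ p := by linarith
  have := ρ.2.1
  have hψG := hψ.growthP hp
  have hφG := (cbp_convexEnv hψ).growthP hp
  obtain ⟨c, hc⟩ := hψ.2.1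
  have hle := convexEnv_le hψ.1 hc
  set g : Rd d → ℝ := fun y => ψ y - convexEnv ψ y with hg
  have hgint : Integrable g ρ.1 := (hψG.integrable_pp hp0 ρ).sub (hφG.integrable_pp hp0 ρ)
  have hg0 : ∀ y, 0 ≤ g y := fun y => sub_nonneg.2 (hle y)
  have hlim : Tendsto (fun n : ℕ => ∫ y, (Metric.closedBall (0 : Rd d) n)ᶜ.indicator g y ∂ρ.1)
      atTop (𝓝 0) := by
    have h := tendsto_integral_of_dominated_convergence (μ := ρ.1)
      (F := fun (n : ℕ) y => (Metric.closedBall (0 : Rd d) n)ᶜ.indicator g y) (f := fun _ => 0) g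
      (fun n => (hgint.indicator Metric.isClosed_closedBall.measurableSet.compl).1) hgint
      (fun n => ae_of_all _ fun y => by
        rw [Real.norm_of_nonneg (indicator_nonneg (fun y _ => hg0 y) _)]
        exact indicator_le_self' (fun y _ => hg0 y) y)
      (ae_of_all _ fun y => by
        obtain ⟨N, hN⟩ := exists_nat_ge ‖y‖
        refine tendsto_atTop_of_eventually_const (i₀ := N) fun n hn => ?_
        have : (N : ℝ) ≤ n := by exact_mod_cast hn
        refine indicator_of_notMem (notMem_compl_iff.2 ?_) _
        simpa using hN.trans this)
    simpa using h
  obtain ⟨n, hn⟩ := (hlim.eventually (ge_mem_nhds (half_pos hε))).exists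
  obtain ⟨κ, R₀, hκ₀, hκψ, hκS⟩ := exists_dilation_of_isCompact hψ.1 hc
    (isCompact_closedBall (0 : Rd d) n) (half_pos hε)
  set R := max R₀ 0
  have hκ : IsDilation κ R := fun y => (hκ₀ y).mono (le_max_left _ _)
  have hmk : ProbabilityTheory.IsMarkovKernel κ := ⟨fun y => (hκ y).prob⟩
  let ρ' : Pp p d := ⟨ρ.1.bind κ, inferInstance, hκ.hasMomentP_bind hp (le_max_right _ _) ρ⟩
  refine ⟨ρ', hκ.convexOrder hp ρ ρ' rfl, ?_⟩
  have hψint : Integrable ψ (ρ.1.bind κ) := hψG.integrable_pp hp0 ρ'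
  have hψint' : Integrable ψ ((κ.comp (ProbabilityTheory.Kernel.const Unit ρ.1)) ()) := by
    rwa [← Measure.comp_eq_comp_const_apply]
  have h1 : ∫ y, ψ y ∂ρ'.1 = ∫ y, ∫ z, ψ z ∂κ y ∂ρ.1 := by
    change ∫ y, ψ y ∂(ρ.1.bind κ) = _
    rw [Measure.comp_eq_comp_const_apply, ProbabilityTheory.Kernel.integral_comp hψint']
    simp
  have h2 : Integrable (fun y => ∫ z, ψ z ∂κ y) ρ.1 := by
    simpa using hψint'.integral_comp
  rw [h1]
  have hind : Integrable (fun y => (Metric.closedBall (0 : Rd d) n)ᶜ.indicator g y) ρ.1 :=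
    hgint.indicator (Metric.isClosed_closedBall (x := (0 : Rd d)) (ε := (n : ℝ))).measurableSet.compl
  have hadd : Integrable
      (fun y => ε / 2 + (Metric.closedBall (0 : Rd d) n)ᶜ.indicator g y) ρ.1 :=
    (integrable_const _).add hind
  calc ∫ y, ∫ z, ψ z ∂κ y ∂ρ.1
      ≤ ∫ y, (convexEnv ψ y + (ε / 2 + (Metric.closedBall (0 : Rd d) n)ᶜ.indicator g y)) ∂ρ.1 := by
        refine integral_mono h2 ((hφG.integrable_pp hp0 ρ).add hadd) fun y => ?_
        by_cases hy : y ∈ Metric.closedBall (0 : Rd d) n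
        · rw [indicator_of_notMem (notMem_compl_iff.2 hy), add_zero]
          exact hκS y hy
        · rw [indicator_of_mem hy]
          have := hκψ y
          simp only [hg]
          linarith
    _ = ∫ y, convexEnv ψ y ∂ρ.1
        + (ε / 2 + ∫ y, (Metric.closedBall (0 : Rd d) n)ᶜ.indicator g y ∂ρ.1) := by
        rw [integral_add (hφG.integrable_pp hp0 ρ) hadd,
          integral_add (integrable_const _) hind]
        simp
    _ ≤ _ := by linarith

/-- A bounded lower estimate of the conjugate of `ψ` gives a lower bound on the dual problem
restricted to convex potentials. -/
lemma exists_convex_dualVal_ge (hp : 1 ≤ p) {X : Type*} [MeasurableSpace X] {μ : Measure X}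
    (ν : Pp p d) {C : X → Measure (Rd d) → ℝ≥0∞}
    (hmono : ∀ x : X, ∀ ρ₁ ρ₂ : Pp p d, ConvexOrder ρ₁.1 ρ₂.1 → C x ρ₂.1 ≤ C x ρ₁.1)
    {ψ : Rd d → ℝ} (hψ : Cbp p ψ) {φ : X → ℝ} (hφ : Integrable φ μ)
    (h : ∀ x, ∀ ρ : Pp p d, C x ρ.1 ≠ ⊤ → φ x ≤ ∫ y, ψ y ∂ρ.1 + (C x ρ.1).toReal) :
    ∃ ψ' : Rd d → ℝ, Cbp p ψ' ∧ ConvexOn ℝ univ ψ' ∧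
      ((∫ x, φ x ∂μ - ∫ y, ψ y ∂ν.1 : ℝ) : EReal) ≤ dualVal p μ ν.1 C ψ' := by
  have hp0 : 0 ≤ p := by linarith
  have hφG := cbp_convexEnv hψ
  obtain ⟨c, hc⟩ := hψ.2.1
  refine ⟨convexEnv ψ, hφG, convexOn_convexEnv hψ.1 hc, ?_⟩
  have h1 : ((∫ x, φ x ∂μ : ℝ) : EReal) ≤ eInt μ (conj p C (convexEnv ψ)) := by
    refine integral_le_eInt hφ fun x => le_iInf fun ρ => ?_
    by_cases hC : C x ρ.1 = ⊤
    · simp [hC]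
    rw [← EReal.coe_ennreal_toReal hC, ← EReal.coe_add, EReal.coe_le_coe_iff]
    refine le_of_forall_pos_le_add fun ε hε => ?_
    obtain ⟨ρ', hρ', hle⟩ := exists_convexOrder_integral_le hp hψ ρ hε
    have h2 := hmono x ρ ρ' hρ'
    have h3 := h x ρ' (ne_top_of_le_ne_top hC h2)
    have h4 := ENNReal.toReal_mono hC h2
    linarith
  have h2 : ∫ y, convexEnv ψ y ∂ν.1 ≤ ∫ y, ψ y ∂ν.1 :=
    integral_mono ((hφG.growthP hp).integrable_pp hp0 ν) ((hψ.growthP hp).integrable_pp hp0 ν)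
      (convexEnv_le hψ.1 hc)
  rw [EReal.coe_sub]
  exact EReal.sub_le_sub h1 (EReal.coe_le_coe_iff.2 h2)

end ConvexOrder

section HahnBanach

variable {d : ℕ} {p : ℝ} {X : Type*} [MeasurableSpace X]

/-- Bounded measurable functions on `X × ℝ^d`. -/
def boundedMeasurable (X : Type*) [MeasurableSpace X] (d : ℕ) :
    Submodule ℝ (X × Rd d → ℝ) where
  carrier := {h | Measurable h ∧ ∃ M, ∀ q, |h q| ≤ M}
  zero_mem' := ⟨measurable_const, 0, fun q => by simp⟩
  add_mem' := by
    rintro h k ⟨hm, M, hM⟩ ⟨km, N, kN⟩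
    exact ⟨hm.add km, M + N, fun q => (abs_add_le _ _).trans (add_le_add (hM q) (kN q))⟩
  smul_mem' := by
    rintro c h ⟨hm, M, hM⟩
    refine ⟨hm.const_smul c, |c| * M, fun q => ?_⟩
    rw [Pi.smul_apply, smul_eq_mul, abs_mul]
    exact mul_le_mul_of_nonneg_left (hM q) (abs_nonneg c)

/-- Dual potentials `(φ, ψ, s)` majorizing `h`, where `s` is the multiplier of the cost. -/
structure Majorizes (p : ℝ) (C : X → Measure (Rd d) → ℝ≥0∞) (h : X × Rd d → ℝ)
    (φ : X → ℝ) (ψ : Rd d → ℝ) (s : ℝ) : Prop where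
  measurable : Measurable φ
  bounded : ∃ M, ∀ x, |φ x| ≤ M
  cbp : Cbp p ψ
  nonneg : 0 ≤ s
  le : ∀ x, ∀ ρ : Pp p d, C x ρ.1 ≠ ⊤ →
    ∫ y, h (x, y) ∂ρ.1 + φ x ≤ ∫ y, ψ y ∂ρ.1 + s * (C x ρ.1).toReal

lemma Cbp.add (hp : 1 ≤ p) {ψ ψ' : Rd d → ℝ} (h : Cbp p ψ) (h' : Cbp p ψ') :
    Cbp p fun y => ψ y + ψ' y := by
  obtain ⟨c, hc⟩ := h.2.1
  obtain ⟨c', hc'⟩ := h'.2.1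
  exact Cbp.of_growthP (GrowthP.add (h.growthP hp) (h'.growthP hp))
    fun y => add_le_add (hc y) (hc' y)

lemma Cbp.const_mul (hp : 1 ≤ p) {ψ : Rd d → ℝ} (h : Cbp p ψ) {a : ℝ} (ha : 0 ≤ a) :
    Cbp p fun y => a * ψ y := by
  obtain ⟨c, hc⟩ := h.2.1
  exact Cbp.of_growthP (GrowthP.const_mul (h.growthP hp) a)
    fun y => mul_le_mul_of_nonneg_left (hc y) ha

lemma integrable_slice {h : X × Rd d → ℝ} (hh : h ∈ boundedMeasurable X d) (x : X)
    (ρ : Pp p d) : Integrable (fun y => h (x, y)) ρ.1 := by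
  have := ρ.2.1
  obtain ⟨hm, M, hM⟩ := hh
  exact Integrable.of_bound (hm.comp measurable_prodMk_left).aestronglyMeasurable M
    (ae_of_all _ fun y => hM (x, y))

lemma Majorizes.add (hp : 1 ≤ p) {C : X → Measure (Rd d) → ℝ≥0∞} {h h' : X × Rd d → ℝ}
    (hh : h ∈ boundedMeasurable X d) (hh' : h' ∈ boundedMeasurable X d)
    {φ φ' : X → ℝ} {ψ ψ' : Rd d → ℝ} {s s' : ℝ} (H : Majorizes p C h φ ψ s)
    (H' : Majorizes p C h' φ' ψ' s') :
    Majorizes p C (h + h') (fun x => φ x + φ' x) (fun y => ψ y + ψ' y) (s + s') := by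
  have hp0 : 0 ≤ p := by linarith
  obtain ⟨M, hM⟩ := H.bounded
  obtain ⟨M', hM'⟩ := H'.bounded
  refine ⟨H.measurable.add H'.measurable,
    ⟨M + M', fun x => (abs_add_le _ _).trans (add_le_add (hM x) (hM' x))⟩,
    H.cbp.add hp H'.cbp, add_nonneg H.nonneg H'.nonneg, fun x ρ hC => ?_⟩
  have h1 := H.le x ρ hC
  have h2 := H'.le x ρ hC
  simp only [Pi.add_apply]
  rw [integral_add (integrable_slice hh x ρ) (integrable_slice hh' x ρ),
    integral_add ((H.cbp.growthP hp).integrable_pp hp0 ρ)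
      ((H'.cbp.growthP hp).integrable_pp hp0 ρ)]
  linarith

lemma Majorizes.smul (hp : 1 ≤ p) {C : X → Measure (Rd d) → ℝ≥0∞} {h : X × Rd d → ℝ}
    {φ : X → ℝ} {ψ : Rd d → ℝ} {s : ℝ} (H : Majorizes p C h φ ψ s) {c : ℝ} (hc : 0 ≤ c) :
    Majorizes p C (c • h) (fun x => c * φ x) (fun y => c * ψ y) (c * s) := by
  obtain ⟨M, hM⟩ := H.bounded
  refine ⟨H.measurable.const_mul c, ⟨|c| * M, fun x => ?_⟩, H.cbp.const_mul hp hc,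
    mul_nonneg hc H.nonneg, fun x ρ hC => ?_⟩
  · rw [abs_mul]
    exact mul_le_mul_of_nonneg_left (hM x) (abs_nonneg c)
  · have h1 := mul_le_mul_of_nonneg_left (H.le x ρ hC) hc
    simp only [Pi.smul_apply, smul_eq_mul, integral_const_mul]
    linarith

/-- The values of the dual potentials majorizing `h`. -/
def majorantValues (p : ℝ) (μ : Measure X) (ν : Measure (Rd d))
    (C : X → Measure (Rd d) → ℝ≥0∞) (D : ℝ) (h : X × Rd d → ℝ) : Set ℝ :=
  {v | ∃ φ ψ s, Majorizes p C h φ ψ s ∧ v = ∫ y, ψ y ∂ν - ∫ x, φ x ∂μ + s * D}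

/-- If the value of potentials majorizing `0` is nonnegative, then a linear functional is
dominated by the values of all majorizing potentials. -/
lemma exists_linear_le_majorants (hp : 1 ≤ p) {μ : Measure X} [IsProbabilityMeasure μ]
    (ν : Pp p d) {C : X → Measure (Rd d) → ℝ≥0∞} {D : ℝ}
    (h0 : ∀ v ∈ majorantValues p μ ν.1 C D 0, 0 ≤ v) :
    ∃ L : (X × Rd d → ℝ) →ₗ[ℝ] ℝ, ∀ h ∈ boundedMeasurable X d,
      ∀ v ∈ majorantValues p μ ν.1 C D h, L h ≤ v := by
  have hp0 : 0 ≤ p := by linarith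
  have hbint : ∀ {φ : X → ℝ}, Measurable φ → (∃ M, ∀ x, |φ x| ≤ M) → Integrable φ μ := by
    rintro φ hφ ⟨M, hM⟩
    exact Integrable.of_bound hφ.aestronglyMeasurable M (ae_of_all _ hM)
  have hbdd : ∀ h ∈ boundedMeasurable X d, BddBelow (majorantValues p μ ν.1 C D h) := by
    rintro h ⟨hm, M, hM⟩
    refine ⟨-M, ?_⟩
    rintro v ⟨φ, ψ, s, H, rfl⟩
    have hφ := hbint H.measurable H.bounded
    obtain ⟨N, hN⟩ := H.bounded
    have h1 := h0 _ ⟨fun x => φ x - M, ψ, s, ⟨H.measurable.sub_const M,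
      ⟨N + |M|, fun x => (abs_sub _ _).trans (add_le_add_left (hN x) _)⟩, H.cbp, H.nonneg,
      fun x ρ hC => ?_⟩, rfl⟩
    · rw [integral_sub hφ (integrable_const _)] at h1
      simp only [integral_const, probReal_univ, one_smul] at h1
      linarith
    · have := ρ.2.1
      have h2 := H.le x ρ hC
      have h3 : ∫ y, (-M) ∂ρ.1 ≤ ∫ y, h (x, y) ∂ρ.1 :=
        integral_mono (integrable_const _) (integrable_slice ⟨hm, M, hM⟩ x ρ)
          fun y => neg_le_of_abs_le (hM (x, y))
      simp only [integral_const, probReal_univ, one_smul] at h3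
      simp only [Pi.zero_apply, integral_zero]
      linarith
  have hne : ∀ h ∈ boundedMeasurable X d, (majorantValues p μ ν.1 C D h).Nonempty := by
    rintro h ⟨hm, M, hM⟩
    refine ⟨_, fun _ => -M, fun _ => 0, 0, ⟨measurable_const, ⟨|M|, fun _ => by simp⟩,
      Cbp.of_growthP (GrowthP.const 0) (c := 0) (fun _ => le_rfl), le_rfl,
      fun x ρ _ => ?_⟩, rfl⟩
    have := ρ.2.1
    have h3 : ∫ y, h (x, y) ∂ρ.1 ≤ ∫ y, M ∂ρ.1 :=
      integral_mono (integrable_slice ⟨hm, M, hM⟩ x ρ) (integrable_const _)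
        fun y => le_of_abs_le (hM (x, y))
    simp only [integral_const, probReal_univ, one_smul] at h3
    simp only [integral_zero]
    linarith
  have hsmul : ∀ c : ℝ, 0 ≤ c → ∀ h v, v ∈ majorantValues p μ ν.1 C D h →
      c * v ∈ majorantValues p μ ν.1 C D (c • h) := by
    rintro c hc h v ⟨φ, ψ, s, H, rfl⟩
    refine ⟨_, _, _, H.smul hp hc, ?_⟩
    rw [integral_const_mul, integral_const_mul]
    ring
  let Q : boundedMeasurable X d → ℝ := fun h => sInf (majorantValues p μ ν.1 C D h.1)
  have hQhom : ∀ c : ℝ, 0 < c → ∀ h, Q (c • h) = c * Q h := by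
    intro c hc h
    refine le_antisymm ?_ ?_
    · rw [← div_le_iff₀' hc]
      refine le_csInf (hne _ h.2) fun v hv => ?_
      rw [div_le_iff₀' hc]
      exact csInf_le (hbdd _ (c • h).2) (hsmul c hc.le _ _ hv)
    · refine le_csInf (hne _ (c • h).2) fun v hv => ?_
      rw [← le_div_iff₀' hc, div_eq_inv_mul]
      refine csInf_le (hbdd _ h.2) ?_
      have := hsmul c⁻¹ (inv_nonneg.2 hc.le) _ _ hv
      rwa [Submodule.coe_smul, smul_smul, inv_mul_cancel₀ hc.ne', one_smul] at this
  have hQadd : ∀ h h', Q (h + h') ≤ Q h + Q h' := by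
    intro h h'
    rw [← sub_le_iff_le_add']
    refine le_csInf (hne _ h'.2) fun v' hv' => ?_
    rw [sub_le_iff_le_add', ← sub_le_iff_le_add]
    refine le_csInf (hne _ h.2) fun v hv => ?_
    rw [sub_le_iff_le_add]
    refine csInf_le (hbdd _ (h + h').2) ?_
    obtain ⟨φ, ψ, s, H, rfl⟩ := hv
    obtain ⟨φ', ψ', s', H', rfl⟩ := hv'
    refine ⟨_, _, _, H.add hp h.2 h'.2 H', ?_⟩
    rw [integral_add ((H.cbp.growthP hp).integrable_pp hp0 ν)
      ((H'.cbp.growthP hp).integrable_pp hp0 ν),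
      integral_add (hbint H.measurable H.bounded) (hbint H'.measurable H'.bounded)]
    ring
  have hQzero : 0 ≤ Q 0 := le_csInf (hne 0 (Submodule.zero_mem _)) fun v hv => h0 v hv
  obtain ⟨g, -, hg⟩ := exists_extension_of_le_sublinear
    (⟨⊥, 0⟩ : boundedMeasurable X d →ₗ.[ℝ] ℝ) Q hQhom hQadd (by
      rintro ⟨h, hh⟩
      obtain rfl := (Submodule.mem_bot ℝ).1 hh
      exact hQzero)
  obtain ⟨L, hL⟩ := g.exists_extend
  refine ⟨L, fun h hh v hv => ?_⟩
  have : L h = g ⟨h, hh⟩ := by rw [← hL]; rfl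
  rw [this]
  exact (hg _).trans (csInf_le (hbdd h hh) hv)

end HahnBanach

section Riesz

open scoped CompactlySupported

/-- A tight positive normalized functional on bounded continuous functions of a locally compact
space is integration against a probability measure. -/
lemma exists_measure_of_tight {Z : Type*} [TopologicalSpace Z] [T2Space Z]
    [LocallyCompactSpace Z] [MeasurableSpace Z] [BorelSpace Z] (L : (Z → ℝ) →ₗ[ℝ] ℝ)
    (hpos : ∀ k : Z → ℝ, Continuous k → (∃ M, ∀ z, |k z| ≤ M) → (∀ z, 0 ≤ k z) → 0 ≤ L k)
    (hone : L (fun _ => 1) = 1)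
    (htight : ∀ ε : ℝ, 0 < ε → ∃ χ : Z → ℝ, Continuous χ ∧ HasCompactSupport χ ∧
      (∀ z, 0 ≤ χ z) ∧ (∀ z, χ z ≤ 1) ∧ 1 - ε ≤ L χ) :
    ∃ π : Measure Z, IsProbabilityMeasure π ∧
      ∀ k : Z → ℝ, Continuous k → (∃ M, ∀ z, |k z| ≤ M) → ∫ z, k z ∂π = L k := by
  have hbd : ∀ f : C_c(Z, ℝ), ∃ M, ∀ z, |f z| ≤ M := fun f =>
    f.hasCompactSupport.exists_bound_of_continuous f.continuous
  let Λ₀ : C_c(Z, ℝ) →ₗ[ℝ] ℝ :=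
    { toFun := fun f => L f
      map_add' := fun f g => by rw [CompactlySupportedContinuousMap.coe_add, map_add]
      map_smul' := fun c f => by
        rw [CompactlySupportedContinuousMap.coe_smul, map_smul]; rfl }
  let Λ : C_c(Z, ℝ) →ₚ[ℝ] ℝ := PositiveLinearMap.mk₀ Λ₀ fun f hf =>
    hpos f f.continuous (hbd f) hf
  set π := RealRMK.rieszMeasure Λ with hπ
  have h_int : ∀ k : Z → ℝ, Continuous k → HasCompactSupport k → ∫ z, k z ∂π = L k :=
    fun k hk hks => RealRMK.integral_rieszMeasure Λ ⟨⟨k, hk⟩, hks⟩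
  have hmono : ∀ k k' : Z → ℝ, Continuous k → Continuous k' → (∃ M, ∀ z, |k z| ≤ M) →
      (∃ M, ∀ z, |k' z| ≤ M) → (∀ z, k z ≤ k' z) → L k ≤ L k' := by
    rintro k k' hk hk' ⟨M, hM⟩ ⟨M', hM'⟩ hle
    have := hpos (k' - k) (hk'.sub hk)
      ⟨M' + M, fun z => (abs_sub _ _).trans (add_le_add (hM' z) (hM z))⟩
      fun z => sub_nonneg.2 (hle z)
    rw [map_sub] at this
    linarith
  have h1b : ∃ M : ℝ, ∀ _ : Z, |(1 : ℝ)| ≤ M := ⟨1, fun _ => by simp⟩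
  have hχb : ∀ {χ : Z → ℝ}, (∀ z, 0 ≤ χ z) → (∀ z, χ z ≤ 1) → ∃ M, ∀ z, |χ z| ≤ M :=
    fun h0 h1 => ⟨1, fun z => by rw [abs_of_nonneg (h0 z)]; exact h1 z⟩
  have hle1 : π univ ≤ 1 := by
    have hreg : π.Regular := inferInstance
    rw [isOpen_univ.measure_eq_iSup_isCompact]
    refine iSup₂_le fun K _ => iSup_le fun hK => ?_
    obtain ⟨f, hf1, -, hfs, hf01⟩ :=
      exists_continuous_one_zero_of_isCompact hK isClosed_empty (disjoint_empty K)
    have h2 := RealRMK.rieszMeasure_le_of_eq_one Λ (f := ⟨f, hfs⟩) (fun z => (hf01 z).1) hK hf1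
    refine h2.trans (ENNReal.ofReal_le_one.2 ?_)
    rw [← hone]
    exact hmono f _ f.continuous continuous_const
      (hχb (fun z => (hf01 z).1) fun z => (hf01 z).2) h1b fun z => (hf01 z).2
  have hfin : IsFiniteMeasure π := ⟨hle1.trans_lt ENNReal.one_lt_top⟩
  have hreal : π.real univ ≤ 1 := ENNReal.toReal_le_of_le_ofReal zero_le_one (by simpa using hle1)
  have hkint : ∀ k : Z → ℝ, Continuous k → (∃ M, ∀ z, |k z| ≤ M) → Integrable k π := by
    rintro k hk ⟨M, hM⟩
    exact Integrable.of_bound hk.aestronglyMeasurable M (ae_of_all _ hM)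
  have hmain : ∀ k : Z → ℝ, Continuous k → (∃ M, ∀ z, |k z| ≤ M) → ∫ z, k z ∂π = L k := by
    rintro k hk ⟨M, hM⟩
    have hM' : ∀ z, |k z| ≤ |M| := fun z => (hM z).trans (le_abs_self M)
    refine eq_of_forall_dist_le fun ε hε => ?_
    obtain ⟨χ, hχ, hχs, hχ0, hχ1, hχL⟩ := htight (ε / (2 * (|M| + 1))) (by positivity)
    set η := ε / (2 * (|M| + 1)) with hη
    have hηε : |M| * η + |M| * η ≤ ε := by
      rw [hη, ← add_mul, ← mul_div_assoc, div_le_iff₀ (by positivity)]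
      nlinarith [abs_nonneg M]
    have hkχ : Continuous fun z => k z * χ z := hk.mul hχ
    have hkχb : ∃ N, ∀ z, |k z * χ z| ≤ N := ⟨|M|, fun z => by
      rw [abs_mul, abs_of_nonneg (hχ0 z)]
      exact (mul_le_of_le_one_right (abs_nonneg _) (hχ1 z)).trans (hM' z)⟩
    have hb : ∀ z, |k z - k z * χ z| ≤ |M| * (1 - χ z) := fun z => by
      rw [← mul_one_sub, abs_mul, abs_of_nonneg (sub_nonneg.2 (hχ1 z))]
      exact mul_le_mul_of_nonneg_right (hM' z) (sub_nonneg.2 (hχ1 z))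
    have hc : Continuous fun z => |M| * (1 - χ z) := by fun_prop
    have hcb : ∃ N, ∀ z, |(|M| * (1 - χ z))| ≤ N := ⟨|M|, fun z => by
      rw [abs_mul, abs_abs, abs_of_nonneg (sub_nonneg.2 (hχ1 z))]
      exact mul_le_of_le_one_right (abs_nonneg _) (by linarith [hχ0 z])⟩
    have hLc : L (fun z => |M| * (1 - χ z)) ≤ |M| * η := by
      have : (fun z => |M| * (1 - χ z)) = |M| • ((fun _ => (1 : ℝ)) - χ) := rfl
      rw [this, map_smul, map_sub, hone, smul_eq_mul]
      exact mul_le_mul_of_nonneg_left (by linarith) (abs_nonneg M)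
    have hIc : ∫ z, |M| * (1 - χ z) ∂π ≤ |M| * η := by
      rw [integral_const_mul, integral_sub (integrable_const _) (hkint χ hχ (hχb hχ0 hχ1)),
        h_int χ hχ hχs]
      refine mul_le_mul_of_nonneg_left ?_ (abs_nonneg M)
      simp only [integral_const, smul_eq_mul, mul_one]
      linarith
    have e1 : |∫ z, k z ∂π - ∫ z, k z * χ z ∂π| ≤ |M| * η := by
      rw [← integral_sub (hkint k hk ⟨M, hM⟩) (hkint _ hkχ hkχb)]
      exact (abs_integral_le_integral_abs.trans (integral_mono
        ((hkint k hk ⟨M, hM⟩).sub (hkint _ hkχ hkχb)).abs (hkint _ hc hcb) hb)).trans hIc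
    have hdb : ∃ N, ∀ z, |k z - k z * χ z| ≤ N := by
      obtain ⟨N, hN⟩ := hcb
      exact ⟨N, fun z => (hb z).trans ((le_abs_self _).trans (hN z))⟩
    have hdL : L (fun z => k z - k z * χ z) = L k - L fun z => k z * χ z := map_sub L k _
    have e2 : L k - L (fun z => k z * χ z) ≤ |M| * η := by
      rw [← hdL]
      exact (hmono _ _ (hk.sub hkχ) hc hdb hcb fun z => le_of_abs_le (hb z)).trans hLc
    have e3 : -(|M| * η) ≤ L k - L (fun z => k z * χ z) := by
      rw [← hdL]
      obtain ⟨N, hN⟩ := hcb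
      have h := hmono (fun z => -(|M| * (1 - χ z))) (fun z => k z - k z * χ z) hc.neg (hk.sub hkχ)
        ⟨N, fun z => by rw [abs_neg]; exact hN z⟩ hdb fun z => neg_le_of_abs_le (hb z)
      have h' : L (fun z => -(|M| * (1 - χ z))) = -L (fun z => |M| * (1 - χ z)) := map_neg L _
      linarith
    rw [h_int _ hkχ (hχs.mul_left)] at e1
    rw [Real.dist_eq, abs_le]
    rw [abs_le] at e1
    constructor <;> linarith [e1.1, e1.2]
  refine ⟨π, ⟨?_⟩, hmain⟩
  have h := hmain (fun _ => 1) continuous_const h1b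
  rw [hone, integral_const, smul_eq_mul, mul_one] at h
  rw [← ENNReal.toReal_eq_one_iff]
  exact h

end Riesz

section Coupling

variable {d : ℕ} {X : Type*} [MeasurableSpace X]

lemma tendsto_integral_cutoff {E : Type*} [NormedAddCommGroup E] [MeasurableSpace E]
    [BorelSpace E] (m : Measure E) [IsProbabilityMeasure m] :
    Tendsto (fun n : ℕ => ∫ y, cutoff (n : ℝ) y ∂m) atTop (𝓝 1) := by
  have h := tendsto_integral_of_dominated_convergence (μ := m)
    (F := fun (n : ℕ) y => cutoff (n : ℝ) y) (f := fun _ => 1) (fun _ => 1)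
    (fun n => (cutoff_continuous (E := E) (n : ℝ)).measurable.aestronglyMeasurable)
    (integrable_const _)
    (fun n => ae_of_all _ fun y => by
      rw [Real.norm_of_nonneg (cutoff_nonneg _ _)]
      exact cutoff_le_one _ _)
    (ae_of_all _ fun y => by
      obtain ⟨N, hN⟩ := exists_nat_ge ‖y‖
      refine tendsto_atTop_of_eventually_const (i₀ := N) fun n hn => cutoff_eq_one (hN.trans ?_)
      exact_mod_cast hn)
  simpa using h

/-- A linear functional on bounded measurable functions which is positive and has the
marginals `μ` and `ν` is represented by a coupling on products `1_A ⊗ g`. -/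
lemma exists_coupling_of_linear [StandardBorelSpace X] (μ : Measure X) [IsProbabilityMeasure μ]
    (ν : Measure (Rd d)) [IsProbabilityMeasure ν] (L : (X × Rd d → ℝ) →ₗ[ℝ] ℝ)
    (hpos : ∀ h ∈ boundedMeasurable X d, (∀ q, 0 ≤ h q) → 0 ≤ L h)
    (hμ : ∀ f : X → ℝ, Measurable f → (∃ M, ∀ x, |f x| ≤ M) →
      L (fun q => f q.1) = ∫ x, f x ∂μ)
    (hν : ∀ g : Rd d → ℝ, Continuous g → (∃ M, ∀ y, |g y| ≤ M) →
      L (fun q => g q.2) = ∫ y, g y ∂ν) :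
    ∃ π : Measure (X × Rd d), IsCoupling π μ ν ∧
      ∀ A : Set X, MeasurableSet A → ∀ g : Rd d → ℝ, Continuous g → (∃ M, ∀ y, |g y| ≤ M) →
        L (fun q => A.indicator (fun _ => 1) q.1 * g q.2)
          = ∫ q, A.indicator (fun _ => 1) q.1 * g q.2 ∂π := by
  have hmono : ∀ h ∈ boundedMeasurable X d, ∀ h' ∈ boundedMeasurable X d,
      (∀ q, h q ≤ h' q) → L h ≤ L h' := fun h hh h' hh' hle => by
    have := hpos (h' - h) (Submodule.sub_mem _ hh' hh) fun q => sub_nonneg.2 (hle q)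
    rw [map_sub] at this
    linarith
  set e : X → ℝ := embeddingReal X
  have he : MeasurableEmbedding e := measurableEmbedding_embeddingReal X
  have hE : MeasurableEmbedding (Prod.map e (id : Rd d → Rd d)) :=
    he.prodMap MeasurableEmbedding.id
  have hEm := hE.measurable
  set m : Measure ℝ := μ.map e
  have hm : IsProbabilityMeasure m := Measure.isProbabilityMeasure_map he.measurable.aemeasurable
  have hmem : ∀ k : ℝ × Rd d → ℝ, Continuous k → (∃ M, ∀ z, |k z| ≤ M) →
      (fun q => k (Prod.map e id q)) ∈ boundedMeasurable X d := by
    rintro k hk ⟨M, hM⟩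
    exact ⟨hk.measurable.comp hEm, M, fun q => hM _⟩
  let L' : (ℝ × Rd d → ℝ) →ₗ[ℝ] ℝ := L ∘ₗ LinearMap.funLeft ℝ ℝ (Prod.map e id)
  have hL' : ∀ k, L' k = L fun q => k (Prod.map e id q) := fun k => rfl
  have hfst : ∀ u : ℝ → ℝ, Continuous u → (∃ M, ∀ t, |u t| ≤ M) →
      L' (fun z => u z.1) = ∫ t, u t ∂m := by
    rintro u hu ⟨M, hM⟩
    rw [hL']
    simp only [Prod.map_fst]
    rw [hμ (fun x => u (e x)) (hu.measurable.comp he.measurable) ⟨M, fun x => hM _⟩,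
      he.integral_map]
  have hsnd : ∀ g : Rd d → ℝ, Continuous g → (∃ M, ∀ y, |g y| ≤ M) →
      L' (fun z => g z.2) = ∫ y, g y ∂ν := fun g hg hgb => hν g hg hgb
  have hone : L' (fun _ => 1) = 1 := by
    rw [hfst (fun _ => 1) continuous_const ⟨1, fun _ => by simp⟩]
    simp
  have hcb : ∀ {E : Type} [NormedAddCommGroup E] (r : ℝ), ∃ M, ∀ t : E, |cutoff r t| ≤ M :=
    fun r => ⟨1, fun t => by rw [abs_of_nonneg (cutoff_nonneg _ _)]; exact cutoff_le_one _ _⟩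
  have htight : ∀ ε : ℝ, 0 < ε → ∃ χ : ℝ × Rd d → ℝ, Continuous χ ∧ HasCompactSupport χ ∧
      (∀ z, 0 ≤ χ z) ∧ (∀ z, χ z ≤ 1) ∧ 1 - ε ≤ L' χ := by
    intro ε hε
    have h1 := (tendsto_integral_cutoff m).eventually (lt_mem_nhds (by linarith : 1 - ε / 2 < 1))
    have h2 := (tendsto_integral_cutoff ν).eventually (lt_mem_nhds (by linarith : 1 - ε / 2 < 1))
    obtain ⟨n, hn1, hn2⟩ := (h1.and h2).exists
    have c1 : Continuous fun z : ℝ × Rd d => cutoff (n : ℝ) z.1 :=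
      (cutoff_continuous _).comp continuous_fst
    have c2 : Continuous fun z : ℝ × Rd d => cutoff (n : ℝ) z.2 :=
      (cutoff_continuous _).comp continuous_snd
    have n1 := fun z : ℝ × Rd d => cutoff_nonneg (n : ℝ) z.1
    have n2 := fun z : ℝ × Rd d => cutoff_nonneg (n : ℝ) z.2
    have o1 := fun z : ℝ × Rd d => cutoff_le_one (n : ℝ) z.1
    have o2 := fun z : ℝ × Rd d => cutoff_le_one (n : ℝ) z.2
    refine ⟨fun z => cutoff (n : ℝ) z.1 * cutoff (n : ℝ) z.2, c1.mul c2, ?_,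
      fun z => mul_nonneg (n1 z) (n2 z), fun z => mul_le_one₀ (o1 z) (n2 z) (o2 z), ?_⟩
    · refine HasCompactSupport.intro ((isCompact_closedBall (0 : ℝ) (n + 1)).prod
        (isCompact_closedBall (0 : Rd d) (n + 1))) fun z hz => ?_
      rw [mem_prod, not_and_or, mem_closedBall_zero_iff, mem_closedBall_zero_iff, not_le,
        not_le] at hz
      rcases hz with hz | hz
      · rw [cutoff_eq_zero hz.le, zero_mul]
      · rw [cutoff_eq_zero (y := z.2) hz.le, mul_zero]
    · have hlin : L' (fun z => cutoff (n : ℝ) z.1 + cutoff (n : ℝ) z.2 - 1)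
          = L' (fun z => cutoff (n : ℝ) z.1) + L' (fun z => cutoff (n : ℝ) z.2)
            - L' (fun _ => 1) := by
        rw [← map_add, ← map_sub]; rfl
      have hle : L' (fun z => cutoff (n : ℝ) z.1 + cutoff (n : ℝ) z.2 - 1)
          ≤ L' fun z => cutoff (n : ℝ) z.1 * cutoff (n : ℝ) z.2 := by
        refine hmono _ (hmem _ ((c1.add c2).sub continuous_const) ⟨1, fun z => ?_⟩) _
          (hmem _ (c1.mul c2) ⟨1, fun z => ?_⟩) fun q => ?_
        · change |cutoff (n : ℝ) z.1 + cutoff (n : ℝ) z.2 - 1| ≤ 1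
          rw [abs_le]
          constructor <;> linarith [n1 z, n2 z, o1 z, o2 z]
        · change |cutoff (n : ℝ) z.1 * cutoff (n : ℝ) z.2| ≤ 1
          rw [abs_of_nonneg (mul_nonneg (n1 z) (n2 z))]
          exact mul_le_one₀ (o1 z) (n2 z) (o2 z)
        · change cutoff (n : ℝ) (e q.1) + cutoff (n : ℝ) q.2 - 1
            ≤ cutoff (n : ℝ) (e q.1) * cutoff (n : ℝ) q.2
          nlinarith [o1 (e q.1, q.2), o2 (e q.1, q.2)]
      rw [hlin, hone, hfst _ (cutoff_continuous _) (hcb _), hsnd _ (cutoff_continuous _)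
        (hcb _)] at hle
      linarith
  obtain ⟨π', hπ', hπL⟩ := exists_measure_of_tight L'
    (fun k hk hkb h0 => hpos _ (hmem k hk hkb) fun q => h0 _) hone htight
  have hfin := hπ'
  have hπfst : π'.map Prod.fst = m := by
    have := Measure.isProbabilityMeasure_map (μ := π') measurable_fst.aemeasurable
    refine ext_of_forall_integral_eq_of_IsFiniteMeasure fun u => ?_
    have hub : ∃ M, ∀ t, |u t| ≤ M := ⟨‖u‖, fun t => u.norm_coe_le_norm t⟩
    rw [integral_map measurable_fst.aemeasurable u.continuous.aestronglyMeasurable,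
      hπL (fun z => u z.1) (u.continuous.comp continuous_fst) (hub.imp fun M h z => h _),
      hfst _ u.continuous hub]
  have hπsnd : π'.map Prod.snd = ν := by
    have := Measure.isProbabilityMeasure_map (μ := π') measurable_snd.aemeasurable
    refine ext_of_forall_integral_eq_of_IsFiniteMeasure fun u => ?_
    have hub : ∃ M, ∀ t, |u t| ≤ M := ⟨‖u‖, fun t => u.norm_coe_le_norm t⟩
    rw [integral_map measurable_snd.aemeasurable u.continuous.aestronglyMeasurable,
      hπL (fun z => u z.2) (u.continuous.comp continuous_snd) (hub.imp fun M h z => h _),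
      hsnd _ u.continuous hub]
  set π : Measure (X × Rd d) := π'.comap (Prod.map e id)
  have hmap : π.map (Prod.map e id) = π' := by
    rw [hE.map_comap]
    refine Measure.restrict_eq_self_of_ae_mem ?_
    have h1 : ∀ᵐ t ∂m, t ∈ range e := by
      refine (ae_map_iff he.measurable.aemeasurable he.measurableSet_range).2 ?_
      exact ae_of_all _ fun x => mem_range_self x
    rw [← hπfst] at h1
    filter_upwards [ae_of_ae_map measurable_fst.aemeasurable h1] with z hz
    obtain ⟨x, hx⟩ := hz
    exact ⟨(x, z.2), Prod.ext hx rfl⟩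
  have hprob : IsProbabilityMeasure π := by
    refine ⟨?_⟩
    rw [← preimage_univ (f := Prod.map e id), ← Measure.map_apply hEm MeasurableSet.univ, hmap]
    exact measure_univ
  have hπ1 : π.map Prod.fst = μ := by
    have h1 : (π.map Prod.fst).map e = μ.map e := by
      rw [Measure.map_map he.measurable measurable_fst]
      change _ = m
      rw [← hπfst, ← hmap, Measure.map_map measurable_fst hEm]
      rfl
    rw [← he.comap_map (π.map Prod.fst), h1, he.comap_map]
  have hπ2 : π.map Prod.snd = ν := by
    rw [← hπsnd, ← hmap, Measure.map_map measurable_snd hEm]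
    rfl
  refine ⟨π, ⟨hprob, hπ1, hπ2⟩, fun A hA g hg ⟨M, hM⟩ => ?_⟩
  refine eq_of_forall_dist_le fun ε hε => ?_
  have heA : MeasurableSet (e '' A) := he.measurableSet_image.2 hA
  obtain ⟨u, hu, huint⟩ := Integrable.exists_boundedContinuous_integral_sub_le (μ := m)
    (f := (e '' A).indicator fun _ => (1 : ℝ)) ((integrable_const _).indicator heA)
    (ε := ε / (2 * (|M| + 1))) (by positivity)
  set η := ε / (2 * (|M| + 1)) with hη
  have hηε : |M| * η + |M| * η ≤ ε := by
    rw [hη, ← add_mul, ← mul_div_assoc, div_le_iff₀ (by positivity)]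
    nlinarith [abs_nonneg M]
  have hind : ∀ x, (e '' A).indicator (fun _ => (1 : ℝ)) (e x) = A.indicator (fun _ => 1) x :=
    fun x => by
      classical
      rw [indicator_apply, indicator_apply, he.injective.mem_set_image]
  have hub : ∀ t, |u t| ≤ ‖u‖ := fun t => u.norm_coe_le_norm t
  set f : X → ℝ := fun x => |A.indicator (fun _ => 1) x - u (e x)| with hf
  have hiA : Measurable (A.indicator fun _ => (1 : ℝ)) := measurable_const.indicator hA
  have hue : Measurable fun x => u (e x) := u.continuous.measurable.comp he.measurable
  have hfm : Measurable f := (hiA.sub hue).abs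
  have hiA1 : ∀ x, |A.indicator (fun _ => (1 : ℝ)) x| ≤ 1 := fun x => by
    classical
    rw [indicator_apply]; split_ifs <;> simp
  have hfb : ∀ x, |f x| ≤ 1 + ‖u‖ := fun x => by
    rw [hf, abs_abs]
    exact (abs_sub _ _).trans (add_le_add (hiA1 x) (hub _))
  have hfμ : ∫ x, f x ∂μ ≤ η := by
    have h := hu
    rw [he.integral_map] at h
    simpa only [hind, Real.norm_eq_abs] using h
  set h1 : X × Rd d → ℝ := fun q => A.indicator (fun _ => 1) q.1 * g q.2
  set h2 : X × Rd d → ℝ := fun q => u (e q.1) * g q.2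
  have hgM : ∀ y, |g y| ≤ |M| := fun y => (hM y).trans (le_abs_self M)
  have hh1 : h1 ∈ boundedMeasurable X d := ⟨(hiA.comp measurable_fst).mul
    (hg.measurable.comp measurable_snd), 1 * |M|, fun q => by
      rw [abs_mul]; exact mul_le_mul (hiA1 _) (hgM _) (abs_nonneg _) zero_le_one⟩
  have hh2b : ∀ z : ℝ × Rd d, |u z.1 * g z.2| ≤ ‖u‖ * |M| := fun z => by
    rw [abs_mul]; exact mul_le_mul (hub _) (hgM _) (abs_nonneg _) (norm_nonneg _)
  have hkc : Continuous fun z : ℝ × Rd d => u z.1 * g z.2 :=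
    (u.continuous.comp continuous_fst).mul (hg.comp continuous_snd)
  have hh2 : h2 ∈ boundedMeasurable X d := hmem _ hkc ⟨_, hh2b⟩
  have hh3 : (fun q : X × Rd d => |M| * f q.1) ∈ boundedMeasurable X d :=
    ⟨(hfm.comp measurable_fst).const_mul _, |M| * (1 + ‖u‖), fun q => by
      rw [abs_mul, abs_abs]; exact mul_le_mul_of_nonneg_left (hfb _) (abs_nonneg _)⟩
  have hdiff : ∀ q, |h1 q - h2 q| ≤ |M| * f q.1 := fun q => by
    simp only [h1, h2]
    rw [← sub_mul, abs_mul, mul_comm]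
    exact mul_le_mul_of_nonneg_right (hgM _) (abs_nonneg _)
  have hbint : ∀ {h : X × Rd d → ℝ}, h ∈ boundedMeasurable X d → Integrable h π := by
    rintro h ⟨hm, N, hN⟩
    exact Integrable.of_bound hm.aestronglyMeasurable N (ae_of_all _ hN)
  have hLf : L (fun q => |M| * f q.1) ≤ |M| * η := by
    have : L (fun q => |M| * f q.1) = |M| * L fun q => f q.1 := by
      rw [← smul_eq_mul, ← map_smul]; rfl
    rw [this, hμ f hfm ⟨_, hfb⟩]
    exact mul_le_mul_of_nonneg_left hfμ (abs_nonneg M)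
  have hIf : ∫ q, |M| * f q.1 ∂π ≤ |M| * η := by
    rw [integral_const_mul, ← integral_map (f := f) measurable_fst.aemeasurable
      hfm.aestronglyMeasurable, hπ1]
    exact mul_le_mul_of_nonneg_left hfμ (abs_nonneg M)
  have heq : L h2 = ∫ q, h2 q ∂π := by
    have h := hπL _ hkc ⟨_, hh2b⟩
    rw [← hmap, hE.integral_map, hL'] at h
    exact h.symm
  have e1 : |∫ q, h1 q ∂π - ∫ q, h2 q ∂π| ≤ |M| * η := by
    rw [← integral_sub (hbint hh1) (hbint hh2)]
    exact (abs_integral_le_integral_abs.trans (integral_mono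
      ((hbint hh1).sub (hbint hh2)).abs (hbint hh3) hdiff)).trans hIf
  have e2 : L h1 - L h2 ≤ |M| * η := by
    rw [← map_sub]
    exact (hmono _ (Submodule.sub_mem _ hh1 hh2) _ hh3 fun q => le_of_abs_le (hdiff q)).trans hLf
  have e3 : L h2 - L h1 ≤ |M| * η := by
    rw [← map_sub]
    refine (hmono _ (Submodule.sub_mem _ hh2 hh1) _ hh3 fun q => ?_).trans hLf
    exact le_of_abs_le ((abs_sub_comm _ _).trans_le (hdiff q))
  rw [Real.dist_eq, abs_le]
  rw [abs_le] at e1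
  constructor <;> linarith [e1.1, e1.2]

end Coupling

section Optimality

variable {d : ℕ} {p : ℝ} {X : Type*} [MeasurableSpace X]

lemma nonneg_of_mem_majorantValues (hp : 1 ≤ p) {μ : Measure X} [IsProbabilityMeasure μ]
    (ν : Pp p d) {C : X → Measure (Rd d) → ℝ≥0∞}
    (hmono : ∀ x : X, ∀ ρ₁ ρ₂ : Pp p d, ConvexOrder ρ₁.1 ρ₂.1 → C x ρ₂.1 ≤ C x ρ₁.1)
    {D : ℝ} (hD0 : 0 ≤ D)
    (hD : ∀ ψ : Rd d → ℝ, Cbp p ψ → ConvexOn ℝ univ ψ → dualVal p μ ν.1 C ψ ≤ (D : EReal)) :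
    ∀ v ∈ majorantValues p μ ν.1 C D 0, 0 ≤ v := by
  rintro v ⟨φ, ψ, s, H, rfl⟩
  have key : ∀ t, 0 < t → s ≤ t → 0 ≤ ∫ y, ψ y ∂ν.1 - ∫ x, φ x ∂μ + t * D := by
    intro t ht hst
    obtain ⟨M, hM⟩ := H.bounded
    have hφ : Integrable φ μ :=
      Integrable.of_bound H.measurable.aestronglyMeasurable M (ae_of_all _ hM)
    obtain ⟨ψ', hψ', hconv, hle⟩ := exists_convex_dualVal_ge hp ν hmono
      (H.cbp.const_mul hp (inv_nonneg.2 ht.le)) (hφ.const_mul t⁻¹) fun x ρ hC => by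
        have h1 := H.le x ρ hC
        simp only [Pi.zero_apply, integral_zero, zero_add] at h1
        have h2 : φ x ≤ ∫ y, ψ y ∂ρ.1 + t * (C x ρ.1).toReal :=
          h1.trans (by gcongr)
        have h3 := mul_le_mul_of_nonneg_left h2 (inv_nonneg.2 ht.le)
        rwa [mul_add, inv_mul_cancel_left₀ ht.ne', ← integral_const_mul] at h3
    have h4 := EReal.coe_le_coe_iff.1 (hle.trans (hD ψ' hψ' hconv))
    rw [integral_const_mul, integral_const_mul, ← mul_sub, inv_mul_le_iff₀ ht] at h4
    linarith
  refine le_of_forall_pos_le_add fun ε hε => ?_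
  have h := key (s + ε / (D + 1)) (add_pos_of_nonneg_of_pos H.nonneg (by positivity))
    (le_add_of_nonneg_right (by positivity))
  have h2 : ε / (D + 1) * D ≤ ε := by
    rw [div_mul_eq_mul_div, div_le_iff₀ (by positivity)]
    nlinarith
  linarith

/-- If `D` bounds the dual problem with convex potentials, then some coupling integrates every
simple minorant of the cost to at most `D`. -/
lemma exists_coupling_integral_le [StandardBorelSpace X] (hp : 1 ≤ p) {μ : Measure X}
    [IsProbabilityMeasure μ] (ν : Pp p d) {C : X → Measure (Rd d) → ℝ≥0∞}
    (hmono : ∀ x : X, ∀ ρ₁ ρ₂ : Pp p d, ConvexOrder ρ₁.1 ρ₂.1 → C x ρ₂.1 ≤ C x ρ₁.1)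
    {D : ℝ} (hD0 : 0 ≤ D)
    (hD : ∀ ψ : Rd d → ℝ, Cbp p ψ → ConvexOn ℝ univ ψ → dualVal p μ ν.1 C ψ ≤ (D : EReal)) :
    ∃ π : Measure (X × Rd d), IsCoupling π μ ν.1 ∧
      ∀ (I : Finset ℕ) (A : ℕ → Set X) (g : ℕ → Rd d → ℝ) (Ψ : Rd d → ℝ),
        (∀ i, MeasurableSet (A i)) → (∀ i, Continuous (g i)) → (∀ i, ∃ M, ∀ y, |g i y| ≤ M) →
        Cbp p Ψ →
        (∀ x, ∀ ρ : Pp p d, C x ρ.1 ≠ ⊤ →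
          ∑ i ∈ I, (A i).indicator (fun _ => 1) x * ∫ y, g i y ∂ρ.1
            ≤ ∫ y, Ψ y ∂ρ.1 + (C x ρ.1).toReal) →
        ∑ i ∈ I, ∫ q, (A i).indicator (fun _ => 1) q.1 * g i q.2 ∂π ≤ ∫ y, Ψ y ∂ν.1 + D := by
  have hν := ν.2.1
  obtain ⟨L, hL⟩ := exists_linear_le_majorants hp ν (nonneg_of_mem_majorantValues hp ν hmono hD0 hD)
  have hzero : Cbp p fun _ : Rd d => (0 : ℝ) :=
    Cbp.of_growthP (GrowthP.const 0) (c := 0) fun _ => le_rfl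
  have hneg : ∀ h : X × Rd d → ℝ, (∀ q, 0 ≤ h q) → h ∈ boundedMeasurable X d → 0 ≤ L h := by
    intro h h0 hh
    have h1 := hL (-h) (Submodule.neg_mem _ hh) _ ⟨fun _ => 0, fun _ => 0, 0,
      ⟨measurable_const, ⟨0, fun _ => by simp⟩, hzero, le_rfl, fun x ρ _ => ?_⟩, rfl⟩
    · rw [map_neg] at h1
      simp only [integral_zero] at h1
      linarith
    · have : 0 ≤ ∫ y, h (x, y) ∂ρ.1 := integral_nonneg fun y => h0 _
      simp only [Pi.neg_apply, integral_neg, integral_zero]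
      linarith
  have hμle : ∀ f : X → ℝ, Measurable f → (∃ M, ∀ x, |f x| ≤ M) →
      L (fun q => f q.1) ≤ ∫ x, f x ∂μ := by
    rintro f hf ⟨M, hM⟩
    refine hL _ ⟨hf.comp measurable_fst, M, fun q => hM _⟩ _ ⟨fun x => -f x, fun _ => 0, 0,
      ⟨hf.neg, ⟨M, fun x => by rw [abs_neg]; exact hM x⟩, hzero, le_rfl, fun x ρ _ => ?_⟩, ?_⟩
    · have := ρ.2.1
      simp
    · simp [integral_neg]
  have hνle : ∀ g : Rd d → ℝ, Continuous g → (∃ M, ∀ y, |g y| ≤ M) →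
      L (fun q => g q.2) ≤ ∫ y, g y ∂ν.1 := by
    rintro g hg ⟨M, hM⟩
    refine hL _ ⟨hg.measurable.comp measurable_snd, M, fun q => hM _⟩ _ ⟨fun _ => 0, g, 0,
      ⟨measurable_const, ⟨0, fun _ => by simp⟩,
        Cbp.of_growthP (GrowthP.of_bounded hg hM) fun y => neg_le_of_abs_le (hM y), le_rfl,
        fun x ρ _ => by simp⟩, by simp⟩
  obtain ⟨π, hπ, hπL⟩ := exists_coupling_of_linear μ ν.1 L (fun h hh h0 => hneg h h0 hh)
    (fun f hf hfb => by
      refine le_antisymm (hμle f hf hfb) ?_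
      have h := hμle (fun x => -f x) hf.neg (by simpa only [abs_neg] using hfb)
      have h' : L (fun q : X × Rd d => -f q.1) = -L fun q => f q.1 := map_neg L _
      rw [h', integral_neg] at h
      linarith)
    (fun g hg hgb => by
      refine le_antisymm (hνle g hg hgb) ?_
      have h := hνle (fun x => -g x) hg.neg (by simpa only [abs_neg] using hgb)
      have h' : L (fun q : X × Rd d => -g q.2) = -L fun q => g q.2 := map_neg L _
      rw [h', integral_neg] at h
      linarith)
  refine ⟨π, hπ, fun I A g Ψ hA hg hgb hΨ hval => ?_⟩
  have hmem : ∀ i, (fun q : X × Rd d => (A i).indicator (fun _ => 1) q.1 * g i q.2)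
      ∈ boundedMeasurable X d := by
    intro i
    obtain ⟨M, hM⟩ := hgb i
    refine ⟨((measurable_const.indicator (hA i)).comp measurable_fst).mul
      ((hg i).measurable.comp measurable_snd), M, fun q => ?_⟩
    by_cases hq : q.1 ∈ A i
    · simpa [indicator_of_mem hq] using hM q.2
    · simpa [indicator_of_notMem hq] using (abs_nonneg _).trans (hM q.2)
  rw [← Finset.sum_congr rfl fun i _ => hπL (A i) (hA i) (g i) (hg i) (hgb i), ← map_sum]
  refine hL _ (Submodule.sum_mem _ fun i _ => hmem i) _ ⟨fun _ => 0, Ψ, 1,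
    ⟨measurable_const, ⟨0, fun _ => by simp⟩, hΨ, zero_le_one, fun x ρ hC => ?_⟩, by simp⟩
  have h := hval x ρ hC
  simp only [Finset.sum_apply]
  rw [integral_finsetSum _ fun i _ => integrable_slice (hmem i) x ρ]
  simpa only [integral_const_mul, add_zero, one_mul] using h

/-- A measurable choice of the first index maximizing `a j x` over `j ≤ N`. -/
lemma exists_measurable_argmax {a : ℕ → X → ℝ} (ha : ∀ i, Measurable (a i)) (N : ℕ) :
    ∃ A : ℕ → Set X, (∀ i, MeasurableSet (A i)) ∧
      ∀ x, ∃ i ≤ N, (∀ j ≤ N, (x ∈ A j ↔ j = i)) ∧ (∀ j ≤ N, a j x ≤ a i x) ∧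
        ∀ j < i, a j x < a i x := by
  classical
  refine ⟨fun i => {x | (∀ j ≤ N, a j x ≤ a i x) ∧ ∀ j < i, a j x < a i x}, fun i => ?_,
    fun x => ?_⟩
  · have h1 : {x | (∀ j ≤ N, a j x ≤ a i x) ∧ ∀ j < i, a j x < a i x}
        = (⋂ j, ⋂ (_ : j ≤ N), {x | a j x ≤ a i x}) ∩ ⋂ j, ⋂ (_ : j < i), {x | a j x < a i x} := by
      ext x
      simp
    beta_reduce
    rw [h1]
    exact (MeasurableSet.iInter fun j => MeasurableSet.iInter fun _ =>
      measurableSet_le (ha j) (ha i)).inter (MeasurableSet.iInter fun j =>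
        MeasurableSet.iInter fun _ => measurableSet_lt (ha j) (ha i))
  · have hex : ∃ i, i ≤ N ∧ ∀ j ≤ N, a j x ≤ a i x := by
      obtain ⟨i, hi, hmax⟩ := Finset.exists_max_image (Finset.range (N + 1)) (fun j => a j x)
        ⟨0, by simp⟩
      exact ⟨i, by simpa [Nat.lt_succ_iff] using hi,
        fun j hj => hmax j (by simpa [Nat.lt_succ_iff] using hj)⟩
    obtain ⟨hi, hmax⟩ := Nat.find_spec hex
    have hlt : ∀ j < Nat.find hex, a j x < a (Nat.find hex) x := by
      intro j hj
      have h := Nat.find_min hex hj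
      push Not at h
      obtain ⟨k, hk, hjk⟩ := h (hj.le.trans hi)
      exact hjk.trans_le (hmax k hk)
    refine ⟨Nat.find hex, hi, fun j hj => ⟨fun hx => ?_, fun h => h ▸ ⟨hmax, hlt⟩⟩, hmax, hlt⟩
    obtain ⟨hx1, hx2⟩ := hx
    rcases lt_trichotomy j (Nat.find hex) with h | h | h
    · exact absurd (hx1 _ hi) (not_le.2 (hlt j h))
    · exact h
    · exact absurd (hmax j hj) (not_le.2 (hx2 _ h))

end Optimality

section Primal

variable {d : ℕ} {p : ℝ} {X : Type*} [MeasurableSpace X]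

lemma lintegral_minorantSup_le (hp : 1 ≤ p) {μ : Measure X} [IsProbabilityMeasure μ]
    (ν : Pp p d) {C : X → Measure (Rd d) → ℝ≥0∞} {D : ℝ} {π : Measure (X × Rd d)}
    [IsProbabilityMeasure π] (hfst : π.fst = μ)
    (hπ : ∀ (I : Finset ℕ) (A : ℕ → Set X) (g : ℕ → Rd d → ℝ) (Ψ : Rd d → ℝ),
        (∀ i, MeasurableSet (A i)) → (∀ i, Continuous (g i)) → (∀ i, ∃ M, ∀ y, |g i y| ≤ M) →
        Cbp p Ψ →
        (∀ x, ∀ ρ : Pp p d, C x ρ.1 ≠ ⊤ →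
          ∑ i ∈ I, (A i).indicator (fun _ => 1) x * ∫ y, g i y ∂ρ.1
            ≤ ∫ y, Ψ y ∂ρ.1 + (C x ρ.1).toReal) →
        ∑ i ∈ I, ∫ q, (A i).indicator (fun _ => 1) q.1 * g i q.2 ∂π ≤ ∫ y, Ψ y ∂ν.1 + D)
    {Ψ : ℕ → Rd d → ℝ} (hΨ : TailDominating p Ψ) (hΨν : ∀ n, ∫ y, Ψ n y ∂ν.1 ≤ 2) {δ : ℝ}
    (hδ : 0 < δ) {U : ℕ → Set X} {f : ℕ → Rd d → ℝ} {n : ℕ → ℕ}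
    (hU : ∀ i, MeasurableSet (U i)) (hf : ∀ i, Continuous (f i))
    (hfb : ∀ i, ∃ M, ∀ y, |f i y| ≤ M) (hU0 : U 0 = univ) (hf0 : f 0 = 0)
    (hval : ∀ i, ∀ x ∈ U i, ∀ ρ : Pp p d,
      ENNReal.ofReal (∫ y, f i y ∂ρ.1 - δ * ∫ y, Ψ (n i) y ∂ρ.1 - δ) ≤ C x ρ.1) :
    ∫⁻ x, minorantSup π.condKernel U f x ∂μ ≤ ENNReal.ofReal (D + 3 * δ) := by
  have hp0 : 0 ≤ p := by linarith
  have hν := ν.2.1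
  set κ := π.condKernel
  have hκm : ∀ i, Measurable fun x => ∫ y, f i y ∂κ x := fun i =>
    ((hf i).stronglyMeasurable.integral_kernel (κ := κ)).measurable
  set a : ℕ → X → ℝ := fun i => (U i).indicator fun x => ∫ y, f i y ∂κ x with ha
  have ham : ∀ i, Measurable (a i) := fun i => (hκm i).indicator (hU i)
  have ha0 : ∀ x, a 0 x = 0 := fun x => by simp [ha, hU0, hf0]
  have hsup : ∀ x, minorantSup κ U f x
      = ⨆ N : ℕ, ⨆ i, ⨆ (_ : i ≤ N), ENNReal.ofReal (a i x) := by
    intro x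
    have h1 : ∀ i, (U i).indicator (fun x => ENNReal.ofReal (∫ y, f i y ∂κ x)) x
        = ENNReal.ofReal (a i x) := fun i => by
      by_cases hx : x ∈ U i
      · simp [ha, hx]
      · simp [ha, hx]
    simp only [minorantSup, h1]
    exact le_antisymm (iSup_le fun i => le_iSup_of_le i (le_iSup_of_le i (le_iSup_of_le le_rfl
      le_rfl))) (iSup_le fun N => iSup_le fun i => iSup_le fun _ =>
        le_iSup (fun i => ENNReal.ofReal (a i x)) i)
  have hmeas : ∀ N : ℕ, Measurable fun x => ⨆ i, ⨆ (_ : i ≤ N), ENNReal.ofReal (a i x) :=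
    fun N => Measurable.iSup fun i => Measurable.iSup fun _ => (ham i).ennreal_ofReal
  rw [lintegral_congr hsup, lintegral_iSup hmeas fun N N' hN x => iSup_le fun i => iSup_le
    fun hi => le_iSup_of_le i (le_iSup_of_le (hi.trans hN) le_rfl)]
  refine iSup_le fun N => ?_
  obtain ⟨A, hA, hAx⟩ := exists_measurable_argmax ham N
  have hsum : ∀ x, ∃ i ≤ N, x ∈ U i ∧ (∀ j ≤ N, a j x ≤ ∫ y, f i y ∂κ x) ∧
      0 ≤ ∫ y, f i y ∂κ x ∧
      ∀ b : ℕ → ℝ, ∑ j ∈ Finset.range (N + 1), (A j).indicator (fun _ => 1) x * b j = b i := by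
    intro x
    obtain ⟨i, hi, hA', hmax, hlt⟩ := hAx x
    have hxU : x ∈ U i := by
      rcases Nat.eq_zero_or_pos i with h | h
      · rw [h, hU0]; exact mem_univ x
      · by_contra hx
        have h1 := hlt 0 h
        rw [ha0] at h1
        simp [ha, hx] at h1
    have hai : a i x = ∫ y, f i y ∂κ x := by simp [ha, hxU]
    refine ⟨i, hi, hxU, fun j hj => hai ▸ hmax j hj, ?_, fun b => ?_⟩
    · rw [← hai, ← ha0 x]
      exact hmax 0 (Nat.zero_le _)
    · rw [Finset.sum_eq_single i]
      · rw [indicator_of_mem ((hA' i hi).2 rfl), one_mul]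
      · intro j hj hji
        rw [indicator_of_notMem, zero_mul]
        exact fun h => hji ((hA' j (by simpa [Nat.lt_succ_iff] using hj)).1 h)
      · intro h
        exact absurd (by simpa [Nat.lt_succ_iff] using hi) h
  set G : X → ℝ := fun x =>
    ∑ j ∈ Finset.range (N + 1), (A j).indicator (fun _ => 1) x * ∫ y, f j y ∂κ x with hG
  have hG0 : ∀ x, 0 ≤ G x := fun x => by
    obtain ⟨i, -, -, -, h0, hs⟩ := hsum x
    rw [hG]
    exact h0.trans_eq (hs fun j => ∫ y, f j y ∂κ x).symm
  have hle : ∀ x, ⨆ i, ⨆ (_ : i ≤ N), ENNReal.ofReal (a i x) ≤ ENNReal.ofReal (G x) := fun x => by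
    obtain ⟨i, -, -, hmax, -, hs⟩ := hsum x
    refine iSup_le fun j => iSup_le fun hj => ENNReal.ofReal_le_ofReal ?_
    exact (hmax j hj).trans_eq (hs fun j => ∫ y, f j y ∂κ x).symm
  have hprod : ∀ j, Integrable
      (fun q : X × Rd d => (A j).indicator (fun _ => 1) q.1 * f j q.2) π := by
    intro j
    obtain ⟨M, hM⟩ := hfb j
    refine Integrable.of_bound (((measurable_const.indicator (hA j)).comp measurable_fst).mul
      ((hf j).measurable.comp measurable_snd)).aestronglyMeasurable M (ae_of_all _ fun q => ?_)
    by_cases hq : q.1 ∈ A j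
    · simpa [indicator_of_mem hq] using hM q.2
    · simpa [indicator_of_notMem hq] using (abs_nonneg _).trans (hM q.2)
  have hπeq : μ.compProd κ = π := by
    rw [← hfst]
    exact π.disintegrate κ
  have hterm : ∀ j, Integrable (fun x => (A j).indicator (fun _ => 1) x * ∫ y, f j y ∂κ x) μ ∧
      ∫ x, (A j).indicator (fun _ => 1) x * ∫ y, f j y ∂κ x ∂μ
        = ∫ q, (A j).indicator (fun _ => 1) q.1 * f j q.2 ∂π := by
    intro j
    have h := hprod j
    rw [← hπeq] at h ⊢
    refine ⟨?_, ?_⟩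
    · simpa only [integral_const_mul, ProbabilityTheory.Kernel.prodMkLeft_apply,
        ProbabilityTheory.Kernel.const_apply] using Integrable.integral_compProd
        (κ := ProbabilityTheory.Kernel.const Unit μ) (η := ProbabilityTheory.Kernel.prodMkLeft Unit κ) (a := ()) h
    · rw [Measure.integral_compProd h]
      simp only [integral_const_mul]
  have hGint : ∫ x, G x ∂μ ≤ D + 3 * δ := by
    rw [hG, integral_finsetSum _ fun j _ => (hterm j).1,
      Finset.sum_congr rfl fun j _ => (hterm j).2]
    set K := (Finset.range (N + 1)).sup n
    have hΨK : GrowthP p fun y => δ * Ψ K y + δ :=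
      GrowthP.add (GrowthP.const_mul (hΨ.growth K) δ) (GrowthP.const δ)
    have h_int : ∀ ρ : Pp p d, ∫ y, (δ * Ψ K y + δ) ∂ρ.1 = δ * ∫ y, Ψ K y ∂ρ.1 + δ := by
      intro ρ
      have := ρ.2.1
      rw [integral_add ((GrowthP.const_mul (hΨ.growth K) δ).integrable_pp hp0 ρ)
        (integrable_const _), integral_const_mul]
      simp
    refine (hπ (Finset.range (N + 1)) A f (fun y => δ * Ψ K y + δ) hA hf hfb
      (Cbp.of_growthP hΨK (c := 0) fun y => ?_) fun x ρ hC => ?_).trans ?_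
    · have := hΨ.nonneg K y
      positivity
    · obtain ⟨i, hi, hxU, -, -, hs⟩ := hsum x
      rw [hs fun j => ∫ y, f j y ∂ρ.1, h_int]
      have h1 : ∫ y, Ψ (n i) y ∂ρ.1 ≤ ∫ y, Ψ K y ∂ρ.1 :=
        integral_mono ((hΨ.growth _).integrable_pp hp0 ρ) ((hΨ.growth _).integrable_pp hp0 ρ)
          fun y => hΨ.mono y (Finset.le_sup (f := n) (by simpa [Nat.lt_succ_iff] using hi))
      have h2 := mul_le_mul_of_nonneg_left h1 hδ.le
      have h3 := (ENNReal.ofReal_le_iff_le_toReal hC).1 (hval i x hxU ρ)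
      linarith
    · rw [h_int]
      have := mul_le_mul_of_nonneg_left (hΨν K) hδ.le
      linarith
  refine (lintegral_mono hle).trans ?_
  rw [← ofReal_integral_eq_lintegral_ofReal
    (integrable_finsetSum _ fun j _ => (hterm j).1) (ae_of_all _ hG0)]
  exact ENNReal.ofReal_le_ofReal hGint

lemma primal_le_of_dualVal_le [TopologicalSpace X] [SecondCountableTopology X] [BorelSpace X]
    [StandardBorelSpace X] (hp : 1 ≤ p) {μ : Measure X} [IsProbabilityMeasure μ] (ν : Pp p d)
    {C : X → Measure (Rd d) → ℝ≥0∞}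
    (hlsc : LowerSemicontinuous fun q : X × Pp p d => C q.1 q.2.1)
    (hconv : ∀ x : X, ∀ ρ₁ ρ₂ : Pp p d, ∀ t : ℝ≥0∞, t ≤ 1 →
      C x (t • ρ₁.1 + (1 - t) • ρ₂.1) ≤ t * C x ρ₁.1 + (1 - t) * C x ρ₂.1)
    (hmono : ∀ x : X, ∀ ρ₁ ρ₂ : Pp p d, ConvexOrder ρ₁.1 ρ₂.1 → C x ρ₂.1 ≤ C x ρ₁.1)
    {D : ℝ} (hD0 : 0 ≤ D)
    (hD : ∀ ψ : Rd d → ℝ, Cbp p ψ → ConvexOn ℝ univ ψ → dualVal p μ ν.1 C ψ ≤ (D : EReal)) :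
    primal μ ν.1 C ≤ ENNReal.ofReal D := by
  obtain ⟨π, ⟨hprob, hfst, hsnd⟩, hπ⟩ := exists_coupling_integral_le hp ν hmono hD0 hD
  obtain ⟨Ψ, hΨ, hΨν⟩ := exists_tailDominating (by linarith : 0 ≤ p) ν
  have hκν : μ.bind π.condKernel = ν.1 := by
    rw [← hfst, ← hsnd]
    change _ = π.snd
    conv_rhs => rw [← π.disintegrate π.condKernel]
    rw [Measure.snd_compProd]
    rfl
  have hd : disint π = π.condKernel := by
    rw [disint, dif_pos (inferInstance : IsFiniteMeasure π)]
  have key : ∀ δ : ℝ, 0 < δ → primal μ ν.1 C ≤ ENNReal.ofReal (D + 4 * δ) := by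
    intro δ hδ
    obtain ⟨U, f, n, hU, hf, hfb, hU0, hf0, hval, hcov⟩ :=
      exists_countable_minorants hp hlsc hconv hΨ hδ
    have h1 := lintegral_minorantSup_le hp ν hfst hπ hΨ hΨν hδ (fun i => (hU i).measurableSet)
      hf hfb hU0 hf0 hval
    calc primal μ ν.1 C ≤ ∫⁻ x, C x (disint π x) ∂μ :=
          iInf_le (fun π : {π : Measure (X × Rd d) // IsCoupling π μ ν.1} =>
            ∫⁻ x, C x (disint π.1 x) ∂μ) ⟨π, hprob, hfst, hsnd⟩
      _ ≤ ∫⁻ x, (minorantSup π.condKernel U f x + ENNReal.ofReal δ) ∂μ := by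
          rw [hd]
          refine lintegral_mono_ae ?_
          filter_upwards [ae_hasMomentP hκν ν.2.2] with x hx
          exact le_minorantSup_add fun t ht => hcov x ⟨π.condKernel x, inferInstance, hx⟩ t ht
      _ ≤ ENNReal.ofReal (D + 3 * δ) + ENNReal.ofReal δ := by
          rw [lintegral_add_right _ measurable_const]
          simpa using h1
      _ = ENNReal.ofReal (D + 4 * δ) := by
          rw [← ENNReal.ofReal_add (by positivity) hδ.le]
          ring_nf
  have hlim : Tendsto (fun δ : ℝ => ENNReal.ofReal (D + 4 * δ)) (𝓝[>] 0)
      (𝓝 (ENNReal.ofReal D)) := by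
    have h : Continuous fun δ : ℝ => ENNReal.ofReal (D + 4 * δ) :=
      ENNReal.continuous_ofReal.comp (by fun_prop)
    simpa using (h.tendsto 0).mono_left nhdsWithin_le_nhds
  exact ge_of_tendsto hlim (eventually_nhdsWithin_of_forall fun δ hδ => key δ hδ)

end Primal

/-- **Restriction of the dual problem to convex potentials** (Theorem 1, forward direction).
If the cost `C` is lsc, convex in its second argument and decreasing for the convex order in
its second argument, then weak-transport duality holds with convex potentials in `C_{b,p}`. -/
theorem weak_transport_duality_convex_potentials
    {X : Type*} [TopologicalSpace X] [PolishSpace X] [MeasurableSpace X] [BorelSpace X]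
    {d : ℕ} {p : ℝ} (hp : 1 ≤ p)
    (μ : Measure X) (hμ : IsProbabilityMeasure μ)
    (ν : Measure (Rd d)) (hν : IsProbabilityMeasure ν) (hνp : HasMomentP p ν)
    (C : X → Measure (Rd d) → ℝ≥0∞)
    (hlsc : LowerSemicontinuous fun q : X × Pp p d => C q.1 q.2.1)
    (hconv : ∀ x : X, ∀ ρ₁ ρ₂ : Pp p d, ∀ t : ℝ≥0∞, t ≤ 1 →
      C x (t • ρ₁.1 + (1 - t) • ρ₂.1) ≤ t * C x ρ₁.1 + (1 - t) * C x ρ₂.1)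
    (hmono : ∀ x : X, ∀ ρ₁ ρ₂ : Pp p d, ConvexOrder ρ₁.1 ρ₂.1 → C x ρ₂.1 ≤ C x ρ₁.1) :
    ((primal μ ν C : ℝ≥0∞) : EReal)
      = ⨆ ψ : {ψ : Rd d → ℝ // Cbp p ψ ∧ ConvexOn ℝ Set.univ ψ},
          dualVal p μ ν C ψ.1 := by
  refine le_antisymm ?_ (iSup_le fun ψ => dualVal_le_primal hp hνp hlsc hconv ψ.2.1)
  set S : EReal := ⨆ ψ : {ψ : Rd d → ℝ // Cbp p ψ ∧ ConvexOn ℝ Set.univ ψ}, dualVal p μ ν C ψ.1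
  have hle : ∀ ψ : Rd d → ℝ, Cbp p ψ → ConvexOn ℝ univ ψ → dualVal p μ ν C ψ ≤ S :=
    fun ψ h h' => le_iSup (fun ψ : {ψ : Rd d → ℝ // Cbp p ψ ∧ ConvexOn ℝ Set.univ ψ} =>
      dualVal p μ ν C ψ.1) ⟨ψ, h, h'⟩
  let ν' : Pp p d := ⟨ν, hν, hνp⟩
  have hS0 : 0 ≤ S := by
    obtain ⟨ψ, h, h', h0⟩ := exists_convex_dualVal_ge hp (μ := μ) ν' hmono
      (ψ := fun _ => 0) (Cbp.of_growthP (GrowthP.const 0) (c := 0) fun _ => le_rfl)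
      (φ := fun _ => 0) (integrable_const _) fun x ρ _ => by simp
    have h1 := h0.trans (hle ψ h h')
    simpa using h1
  induction hS : S with
  | bot => exact absurd hS0 (by rw [hS]; simp)
  | top => exact le_top
  | coe D =>
    have hD0 : 0 ≤ D := by rw [hS] at hS0; exact_mod_cast hS0
    have h := primal_le_of_dualVal_le hp ν' hlsc hconv hmono hD0 fun ψ h h' => hS ▸ hle ψ h h'
    have h2 := EReal.coe_ennreal_le_coe_ennreal_iff.2 h
    rwa [EReal.coe_ennreal_ofReal, max_eq_left hD0] at h2
end

section
/- Let X be a Polish space, p ≥ 1, and let C : X × P_p(ℝ^d) → [0,∞] be lower semicontinuous and convex in its second argument. If for all μ ∈ P(X) and all ν ∈ P_p(ℝ^d) the duality inf_{π ∈ Π(μ,ν)} ∫_X C(x, π_x) dμ(x) = sup { ∫_X ψ^C dμ − ∫_{ℝ^d} ψ dν : ψ ∈ C_{b,p}(ℝ^d), ψ convex } holds, then C is decreasing in the convex order in its second argument, i.e. ρ₁ ≼_c ρ₂ implies C(x,ρ₁) ≥ C(x,ρ₂) for all x ∈ X. -/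
open MeasureTheory Set Filter Topology
open scoped ENNReal

theorem HasMomentP.integrable_of_Cbp {p : ℝ} (hp : 1 ≤ p) {d : ℕ} {ρ : Measure (Rd d)}
    [IsProbabilityMeasure ρ] (hρ : HasMomentP p ρ) {ψ : Rd d → ℝ} (hψ : Cbp p ψ) :
    Integrable ψ ρ := by
  obtain ⟨hcont, ⟨c, hc⟩, K, hK, y₀, hbound⟩ := hψ
  have hp0 : 0 < p := by linarith
  have hid : MemLp (fun y : Rd d => y) (ENNReal.ofReal p) ρ := by
    refine (integrable_norm_rpow_iff (by fun_prop) (by simpa using hp0) ENNReal.ofReal_ne_top).1 ?_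
    rw [ENNReal.toReal_ofReal hp0.le]
    refine ⟨by fun_prop (disch := exact hp0.le), ?_⟩
    rw [hasFiniteIntegral_iff_ofReal (Eventually.of_forall fun y => by positivity)]
    exact hρ.lt_top
  have hsub := (hid.sub (memLp_const y₀)).integrable_norm_rpow (by simpa using hp0)
    ENNReal.ofReal_ne_top
  rw [ENNReal.toReal_ofReal hp0.le] at hsub
  refine Integrable.mono' ((integrable_const |c|).add
    (((integrable_const (1 : ℝ)).add hsub).const_mul K)) hcont.aestronglyMeasurable
    (Eventually.of_forall fun y => ?_)
  have hnonneg : 0 ≤ K * (1 + ‖y - y₀‖ ^ p) := by positivity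
  have h₁ := hc y
  have h₂ := hbound y
  have h₃ := neg_abs_le c
  have h₄ := abs_nonneg c
  simp only [Pi.add_apply, Pi.sub_apply, Real.norm_eq_abs]
  exact abs_le.2 ⟨by linarith, by linarith⟩

theorem eInt_coe_of_integrable {α : Type*} [MeasurableSpace α] {μ : Measure α} {f : α → ℝ}
    (hf : Integrable f μ) : eInt μ (fun y => (f y : EReal)) = ((∫ y, f y ∂μ : ℝ) : EReal) := by
  have hpos : (∫⁻ y, ENNReal.ofReal (f y) ∂μ) ≠ ⊤ := hf.lintegral_lt_top.ne
  have hneg : (∫⁻ y, ENNReal.ofReal (-f y) ∂μ) ≠ ⊤ := hf.neg.lintegral_lt_top.ne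
  have hcoe (r : ℝ) : erealToENN (r : EReal) = ENNReal.ofReal r := by simp [erealToENN]
  simp only [eInt, ← EReal.coe_neg, hcoe]
  rw [integral_eq_lintegral_pos_part_sub_lintegral_neg_part hf, EReal.coe_sub,
    EReal.coe_ennreal_toReal hpos, EReal.coe_ennreal_toReal hneg]

theorem ConvexOrder.integral_le {p : ℝ} (hp : 1 ≤ p) {d : ℕ} {ρ₁ ρ₂ : Pp p d}
    (h : ConvexOrder ρ₁.1 ρ₂.1) {ψ : Rd d → ℝ} (hψ : Cbp p ψ) (hconv : ConvexOn ℝ univ ψ) :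
    ∫ y, ψ y ∂ρ₁.1 ≤ ∫ y, ψ y ∂ρ₂.1 := by
  have := ρ₁.2.1
  have := ρ₂.2.1
  have hle := h ψ hconv
  rw [eInt_coe_of_integrable (ρ₁.2.2.integrable_of_Cbp hp hψ),
    eInt_coe_of_integrable (ρ₂.2.2.integrable_of_Cbp hp hψ)] at hle
  exact_mod_cast hle

theorem IsCoupling.disint_dirac {X Y : Type*} [MeasurableSpace X] [MeasurableSingletonClass X]
    [MeasurableSpace Y] [StandardBorelSpace Y] [Nonempty Y] {π : Measure (X × Y)} {x : X}
    {ν : Measure Y} (h : IsCoupling π (Measure.dirac x) ν) : disint π x = ν := by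
  obtain ⟨hprob, hfst, hsnd⟩ := h
  have hfst' : π.fst = Measure.dirac x := hfst
  have hnull : π (Prod.fst ⁻¹' {x}ᶜ) = 0 := by
    rw [← Measure.map_apply measurable_fst (measurableSet_singleton x).compl, hfst]
    simp
  ext s hs
  have hset : π ({x} ×ˢ s) = π (Prod.snd ⁻¹' s) := by
    refine measure_congr (Filter.eventuallyEq_set.2 ?_)
    filter_upwards [measure_eq_zero_iff_ae_notMem.1 hnull] with q hq
    have hq' : q.1 = x := by simpa using hq
    simp [hq']
  have hfin : IsFiniteMeasure π := inferInstance
  rw [disint, dif_pos hfin,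
    Measure.condKernel_apply_of_ne_zero (by simp [hfst']), hfst', hset,
    ← Measure.map_apply measurable_snd hs, hsnd]
  simp

theorem primal_dirac {X : Type*} [MeasurableSpace X] [MeasurableSingletonClass X] {d : ℕ}
    (x : X) (ν : Measure (Rd d)) [IsProbabilityMeasure ν] (C : X → Measure (Rd d) → ℝ≥0∞) :
    primal (Measure.dirac x) ν C = C x ν := by
  have hprod : IsCoupling ((Measure.dirac x).prod ν) (Measure.dirac x) ν :=
    ⟨inferInstance, by simp [Measure.map_fst_prod], by simp [Measure.map_snd_prod]⟩
  have : Nonempty {π : Measure (X × Rd d) // IsCoupling π (Measure.dirac x) ν} := ⟨⟨_, hprod⟩⟩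
  have hval (π : {π : Measure (X × Rd d) // IsCoupling π (Measure.dirac x) ν}) :
      ∫⁻ z, C z (disint π.1 z) ∂(Measure.dirac x) = C x ν := by
    rw [lintegral_dirac, π.2.disint_dirac]
  simp only [primal, hval, iInf_const]

/-- **Theorem 1, converse direction.** If weak-transport duality with convex potentials holds
for all marginals `μ ∈ P(X)`, `ν ∈ P_p(ℝ^d)`, then the cost `C` is decreasing for the
convex order in its second argument. -/
theorem convexOrder_decreasing_of_duality
    {X : Type*} [TopologicalSpace X] [PolishSpace X] [MeasurableSpace X] [BorelSpace X]
    {d : ℕ} {p : ℝ} (hp : 1 ≤ p)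
    (C : X → Measure (Rd d) → ℝ≥0∞)
    (hlsc : LowerSemicontinuous fun q : X × Pp p d => C q.1 q.2.1)
    (hconv : ∀ x : X, ∀ ρ₁ ρ₂ : Pp p d, ∀ t : ℝ≥0∞, t ≤ 1 →
      C x (t • ρ₁.1 + (1 - t) • ρ₂.1) ≤ t * C x ρ₁.1 + (1 - t) * C x ρ₂.1)
    (hdual : ∀ μ : Measure X, IsProbabilityMeasure μ →
      ∀ ν : Measure (Rd d), IsProbabilityMeasure ν → HasMomentP p ν →
      ((primal μ ν C : ℝ≥0∞) : EReal)
        = ⨆ ψ : {ψ : Rd d → ℝ // Cbp p ψ ∧ ConvexOn ℝ Set.univ ψ},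
            dualVal p μ ν C ψ.1) :
    ∀ x : X, ∀ ρ₁ ρ₂ : Pp p d, ConvexOrder ρ₁.1 ρ₂.1 → C x ρ₂.1 ≤ C x ρ₁.1 := by
  intro x ρ₁ ρ₂ hord
  have := ρ₁.2.1
  have := ρ₂.2.1
  have h₁ := hdual (Measure.dirac x) inferInstance ρ₁.1 ρ₁.2.1 ρ₁.2.2
  have h₂ := hdual (Measure.dirac x) inferInstance ρ₂.1 ρ₂.2.1 ρ₂.2.2
  rw [primal_dirac] at h₁ h₂
  rw [← EReal.coe_ennreal_le_coe_ennreal_iff, h₁, h₂]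
  refine iSup_mono fun ψ => EReal.sub_le_sub le_rfl ?_
  exact_mod_cast hord.integral_le hp ψ.2.1 ψ.2.2
end
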